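/- Let (I|J, I'|J') be a cortege for m,n with |I| ≥ |I'|, let (I°, I•, J°, J•) be its refinement, and suppose that I and I' are weakly separated, J and J' are weakly separated, and one of the following four cases holds, defining c ∈ ℤ accordingly: (1) I• = ∅ and J• admits a partition J• = J₁ ∪ J₂ with J₁ < J° < J₂, and c = |J₂| − |J₁|; (2) J• = ∅ and I• admits a partition I• = I₁ ∪ I₂ with I₁ < I° < I₂, and c = |I₂| − |I₁|; (3) I° < I• and J• < J°, and c = |I•| − |J•|; (4) I• < I° and J° < J•, and c = |J•| − |I•|. Then for every field K, every nonzero q ∈ K, every associative unital K-algebra A, and every m×n q-matrix x with entries in A, one has [I|J]·[I'|J'] = q^c [I'|J']·[I|J]. -/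

import Mathlib

/-- Number of inversions of a permutation of `Fin k`. -/
def permInversions {k : ℕ} (σ : Equiv.Perm (Fin k)) : ℕ :=
  (Finset.univ.filter (fun p : Fin k × Fin k => p.1 < p.2 ∧ σ p.2 < σ p.1)).card

/-- The quantum minor `[I|J]_q` of a matrix `x` (indexed by `ℕ`, rows/columns `1,…`),
with row set `I` and column set `J` (both listed in increasing order). -/
noncomputable def qMinor {K : Type} [Field K] {A : Type} [Ring A] [Algebra K A]
    (q : K) (x : ℕ → ℕ → A) (I J : Finset ℕ) : A :=
  if h : I.card = J.card then
    ∑ σ : Equiv.Perm (Fin I.card),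
      ((-q) ^ permInversions σ) •
        (List.ofFn (fun d : Fin I.card =>
          x (I.orderEmbOfFin rfl d) (J.orderEmbOfFin h.symm (σ d)))).prod
  else 0

/-- The flag quantum minor `[J]_q := [{1,…,|J|} | J]_q`. -/
noncomputable def flagMinor {K : Type} [Field K] {A : Type} [Ring A] [Algebra K A]
    (q : K) (x : ℕ → ℕ → A) (J : Finset ℕ) : A :=
  qMinor q x (Finset.Icc 1 J.card) J

/-- Manin's relations: `x` is an `m × n` `q`-matrix. -/
def IsQMatrix {K : Type} [Field K] {A : Type} [Ring A] [Algebra K A]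
    (q : K) (m n : ℕ) (x : ℕ → ℕ → A) : Prop :=
  (∀ i j k, 1 ≤ i → i ≤ m → 1 ≤ j → j < k → k ≤ n →
    x i j * x i k = q • (x i k * x i j)) ∧
  (∀ i l j, 1 ≤ i → i < l → l ≤ m → 1 ≤ j → j ≤ n →
    x i j * x l j = q • (x l j * x i j)) ∧
  (∀ i l j k, 1 ≤ i → i < l → l ≤ m → 1 ≤ j → j < k → k ≤ n →
    x i k * x l j = x l j * x i k) ∧
  (∀ i l j k, 1 ≤ i → i < l → l ≤ m → 1 ≤ j → j < k → k ≤ n →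
    x i j * x l k - x l k * x i j = (q - q⁻¹) • (x i k * x l j))

/-- `X < Y` elementwise: every element of `X` is smaller than every element of `Y`. -/
def finsetLT (X Y : Finset ℕ) : Prop := ∀ a ∈ X, ∀ b ∈ Y, a < b

/-- One-sided weak separation: `|I| ≥ |J|` and `J - I` has a partition `J₁ ∪ J₂`
with `J₁ < I - J < J₂`. -/
def WShalf (I J : Finset ℕ) : Prop :=
  J.card ≤ I.card ∧ ∃ J₁ J₂ : Finset ℕ, Disjoint J₁ J₂ ∧ J₁ ∪ J₂ = J \ I ∧
    finsetLT J₁ (I \ J) ∧ finsetLT (I \ J) J₂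

/-- `I` and `J` are weakly separated. -/
def WeaklySeparated (I J : Finset ℕ) : Prop := WShalf I J ∨ WShalf J I

/-- `Inv(A,B)`: the number of pairs `(a,b) ∈ A × B` with `a > b`. -/
def invPairs (A B : Finset ℕ) : ℕ := ((A ×ˢ B).filter (fun p => p.2 < p.1)).card

/-- A cortege `(I|J, I'|J')` for `m,n`. -/
structure Cortege (m n : ℕ) where
  I : Finset ℕ
  J : Finset ℕ
  I' : Finset ℕ
  J' : Finset ℕ
  hIm : I ⊆ Finset.Icc 1 m
  hI'm : I' ⊆ Finset.Icc 1 m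
  hJn : J ⊆ Finset.Icc 1 n
  hJ'n : J' ⊆ Finset.Icc 1 n
  hIJ : I.card = J.card
  hI'J' : I'.card = J'.card

/-- Elements of the ground set `Y^r ⊔ Y^c`: `Sum.inl i` is a row index, `Sum.inr j`
a column index. -/
abbrev Elt := ℕ ⊕ ℕ

/-- The linear order on `Y^r ⊔ Y^c`: rows in increasing order first, then columns
in decreasing order. -/
def cLT : Elt → Elt → Prop
  | Sum.inl i, Sum.inl i' => i < i'
  | Sum.inl _, Sum.inr _ => True
  | Sum.inr _, Sum.inl _ => False
  | Sum.inr j, Sum.inr j' => j' < j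

instance : DecidableRel cLT := fun a b =>
  match a, b with
  | Sum.inl i, Sum.inl i' => inferInstanceAs (Decidable (i < i'))
  | Sum.inl _, Sum.inr _ => inferInstanceAs (Decidable True)
  | Sum.inr _, Sum.inl _ => inferInstanceAs (Decidable False)
  | Sum.inr j, Sum.inr j' => inferInstanceAs (Decidable (j' < j))

/-- Two elements lie on the same side (both rows or both columns). -/
abbrev sameSide (a b : Elt) : Prop := a.isLeft = b.isLeft

/-- The underlying numerical index of an element. -/
abbrev eVal : Elt → ℕ := Sum.elim id id

/-- The numerically smaller member of a couple (used for couples lying in one side). -/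
def numMin (p : Elt × Elt) : Elt := if eVal p.1 ≤ eVal p.2 then p.1 else p.2

namespace Cortege
variable {m n : ℕ}

/-- White elements of the refinement: `I° = I - I'` (rows) and `J° = J - J'` (columns). -/
def whites (S : Cortege m n) : Finset Elt :=
  (S.I \ S.I').image Sum.inl ∪ (S.J \ S.J').image Sum.inr

/-- Black elements of the refinement: `I• = I' - I` (rows) and `J• = J' - J` (columns). -/
def blacks (S : Cortege m n) : Finset Elt :=
  (S.I' \ S.I).image Sum.inl ∪ (S.J' \ S.J).image Sum.inr

/-- The ground set `Y^r ⊔ Y^c` of a cortege. -/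
def ground (S : Cortege m n) : Finset Elt := S.whites ∪ S.blacks

end Cortege

/-- `M` is a feasible matching for the cortege `S`.  Couples are stored as pairs
`(a, b)` with `a` preceding `b` in the linear order `cLT`. -/
def IsFeasible {m n : ℕ} (S : Cortege m n) (M : Finset (Elt × Elt)) : Prop :=
  (∀ p ∈ M, p.1 ∈ S.ground ∧ p.2 ∈ S.ground ∧ cLT p.1 p.2) ∧
  (∀ y ∈ S.ground, ∃! p, p ∈ M ∧ (p.1 = y ∨ p.2 = y)) ∧
  (∀ p ∈ M, (sameSide p.1 p.2 → (p.1 ∈ S.whites ↔ p.2 ∈ S.blacks)) ∧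
            (¬ sameSide p.1 p.2 → (p.1 ∈ S.whites ↔ p.2 ∈ S.whites))) ∧
  (∀ p ∈ M, ∀ p' ∈ M, ¬ (cLT p.1 p'.1 ∧ cLT p'.1 p.2 ∧ cLT p.2 p'.2))

/-- The set of elements covered by a set of couples. -/
def coveredBy (Φ : Finset (Elt × Elt)) : Finset Elt :=
  Φ.image Prod.fst ∪ Φ.image Prod.snd

/-- `T` is obtained from `S` by the index exchange operation using the couples `Φ`:
the intersections and unions of the row (resp. column) sets are unchanged, and
the white/black color is flipped exactly on the elements covered by `Φ`. -/
def IsExchange {m n : ℕ} (S T : Cortege m n) (Φ : Finset (Elt × Elt)) : Prop :=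
  S.I ∩ S.I' = T.I ∩ T.I' ∧ S.J ∩ S.J' = T.J ∩ T.J' ∧
  S.I ∪ S.I' = T.I ∪ T.I' ∧ S.J ∪ S.J' = T.J ∪ T.J' ∧
  ∀ a ∈ S.ground,
    (a ∈ coveredBy Φ → (a ∈ S.whites ↔ a ∈ T.blacks)) ∧
    (a ∉ coveredBy Φ → (a ∈ S.whites ↔ a ∈ T.whites))

/-- The couples of `M` on which the white/black colorings of `S` and `T` differ. -/
def differSet {m n : ℕ} (S T : Cortege m n) (M : Finset (Elt × Elt)) :
    Finset (Elt × Elt) :=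
  M.filter (fun p =>
    ¬ (p.1 ∈ S.whites ↔ p.1 ∈ T.whites) ∨ ¬ (p.2 ∈ S.whites ↔ p.2 ∈ T.whites))

/-- `ζ°(S;Φ)`: the number of couples of `Φ` lying within one side whose numerically
smaller element is white. -/
def zetaWhite {m n : ℕ} (S : Cortege m n) (Φ : Finset (Elt × Elt)) : ℕ :=
  (Φ.filter (fun p => sameSide p.1 p.2 ∧ numMin p ∈ S.whites)).card

/-- `ζ•(S;Φ)`: the number of couples of `Φ` lying within one side whose numerically
smaller element is black. -/
def zetaBlack {m n : ℕ} (S : Cortege m n) (Φ : Finset (Elt × Elt)) : ℕ :=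
  (Φ.filter (fun p => sameSide p.1 p.2 ∧ numMin p ∈ S.blacks)).card

/-- Configurations for an (indexed) family of corteges: pairs of a member of the family
and a feasible matching for it. -/
def Config {m n : ℕ} {ι : Type} (F : ι → Cortege m n) : Type :=
  {p : ι × Finset (Elt × Elt) // IsFeasible (F p.1) p.2}

/-- The quadruple `(F, G, α, β)` is `q`-balanced. -/
def QBalanced {m n : ℕ} {ι κ : Type} (F : ι → Cortege m n) (G : κ → Cortege m n)
    (α : ι → ℤ) (β : κ → ℤ) : Prop :=
  ∃ γ : Config F ≃ Config G, ∀ c : Config F,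
    ((γ c).1.2 = c.1.2) ∧
    IsExchange (F c.1.1) (G (γ c).1.1) (differSet (F c.1.1) (G (γ c).1.1) c.1.2) ∧
    β (γ c).1.1 - α c.1.1 =
      (zetaWhite (F c.1.1) (differSet (F c.1.1) (G (γ c).1.1) c.1.2) : ℤ) -
      (zetaBlack (F c.1.1) (differSet (F c.1.1) (G (γ c).1.1) c.1.2) : ℤ)

/-- The two families `F`, `G` are (jointly) homogeneous. -/
def Homogeneous {m n : ℕ} {ι κ : Type} (F : ι → Cortege m n) (G : κ → Cortege m n) : Prop :=
  ∀ S T : Cortege m n,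
    ((∃ i, F i = S) ∨ (∃ k, G k = S)) → ((∃ i, F i = T) ∨ (∃ k, G k = T)) →
    S.I ∪ S.I' = T.I ∪ T.I' ∧ S.I ∩ S.I' = T.I ∩ T.I' ∧
    S.J ∪ S.J' = T.J ∪ T.J' ∧ S.J ∩ S.J' = T.J ∩ T.J'

namespace QuantumMinor

section Exchange

variable {K : Type*} [Field K] {M M' : Type*} [AddCommGroup M] [Module K M]
  [AddCommGroup M'] [Module K M']

/-- The action of the `R`-matrix of type `A` on the coefficients of a tensor of degree two. -/
def exch (q : K) (v : ℕ → ℕ → M) (a c : ℕ) : M :=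
  if a = c then q • v a c else if a < c then v a c else v a c + (q - q⁻¹) • v c a

/-- The letter `a` is moved through the word `c` by successive applications of `exch`. -/
def exchLetter (q : K) : (ℕ → List ℕ → M) → ℕ → List ℕ → M
  | v, a, [] => v a []
  | v, a, c :: cs =>
    exchLetter q (fun a' cs' => exch q (fun a'' c'' => v a'' (c'' :: cs')) a' c) a cs
  termination_by _ _ cs => cs.length

/-- The word `a` is moved through the word `c` by successive applications of `exch`. -/
def exchWord (q : K) : (List ℕ → List ℕ → M) → List ℕ → List ℕ → M
  | v, [], cs => v [] cs
  | v, a :: as, cs =>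
    exchLetter q (fun a' cs' => exchWord q (fun as' cs'' => v (a' :: as') cs'') as cs') a cs
  termination_by _ as _ => as.length

lemma exchLetter_nil (q : K) (v : ℕ → List ℕ → M) (a : ℕ) : exchLetter q v a [] = v a [] := by
  rw [exchLetter]

lemma exchLetter_cons (q : K) (v : ℕ → List ℕ → M) (a c : ℕ) (cs : List ℕ) :
    exchLetter q v a (c :: cs) =
      exchLetter q (fun a' cs' => exch q (fun a'' c'' => v a'' (c'' :: cs')) a' c) a cs := by
  rw [exchLetter]

lemma exchWord_nil (q : K) (v : List ℕ → List ℕ → M) (cs : List ℕ) :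
    exchWord q v [] cs = v [] cs := by
  rw [exchWord]

lemma exchWord_cons (q : K) (v : List ℕ → List ℕ → M) (a : ℕ) (as cs : List ℕ) :
    exchWord q v (a :: as) cs =
      exchLetter q (fun a' cs' => exchWord q (fun as' cs'' => v (a' :: as') cs'') as cs') a cs := by
  rw [exchWord]

lemma map_exch (φ : M →ₗ[K] M') (q : K) (v : ℕ → ℕ → M) (a c : ℕ) :
    φ (exch q v a c) = exch q (fun a c => φ (v a c)) a c := by
  unfold exch
  split_ifs <;> simp

lemma map_exchLetter (φ : M →ₗ[K] M') (q : K) (v : ℕ → List ℕ → M) (a : ℕ) (cs : List ℕ) :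
    φ (exchLetter q v a cs) = exchLetter q (fun a cs => φ (v a cs)) a cs := by
  induction cs generalizing v with
  | nil => simp [exchLetter_nil]
  | cons c cs ih => simp only [exchLetter_cons, ih, map_exch]

lemma map_exchWord (φ : M →ₗ[K] M') (q : K) (v : List ℕ → List ℕ → M) (as cs : List ℕ) :
    φ (exchWord q v as cs) = exchWord q (fun as cs => φ (v as cs)) as cs := by
  induction as generalizing v cs with
  | nil => simp [exchWord_nil]
  | cons a as ih => simp only [exchWord_cons, map_exchLetter, ih]

lemma exch_apply {ι : Type*} (q : K) (v : ℕ → ℕ → ι → M) (a c : ℕ) (i : ι) :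
    exch q v a c i = exch q (fun a c => v a c i) a c :=
  map_exch (LinearMap.proj (R := K) (φ := fun _ : ι => M) i) q v a c

lemma exchLetter_apply {ι : Type*} (q : K) (v : ℕ → List ℕ → ι → M) (a : ℕ) (cs : List ℕ)
    (i : ι) : exchLetter q v a cs i = exchLetter q (fun a cs => v a cs i) a cs :=
  map_exchLetter (LinearMap.proj (R := K) (φ := fun _ : ι => M) i) q v a cs

lemma exchWord_apply {ι : Type*} (q : K) (v : List ℕ → List ℕ → ι → M) (as cs : List ℕ)
    (i : ι) : exchWord q v as cs i = exchWord q (fun as cs => v as cs i) as cs :=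
  map_exchWord (LinearMap.proj (R := K) (φ := fun _ : ι => M) i) q v as cs

/-- A function on words is `q`-alternating: it vanishes on words with two equal adjacent
letters, and interchanging an adjacent ascending pair multiplies it by `-q`. -/
def IsAlt (q : K) (f : List ℕ → M) : Prop :=
  ∀ u w a, f (u ++ a :: a :: w) = 0 ∧
    ∀ b, a < b → f (u ++ b :: a :: w) = -(q • f (u ++ a :: b :: w))

lemma IsAlt.map {q : K} {f : List ℕ → M} (hf : IsAlt q f) (φ : M →ₗ[K] M') :
    IsAlt q (fun w => φ (f w)) := by
  intro u w a
  refine ⟨by simp [(hf u w a).1], fun b hb => ?_⟩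
  simp [(hf u w a).2 b hb]

lemma IsAlt.append_left {q : K} {f : List ℕ → M} (hf : IsAlt q f) (p : List ℕ) :
    IsAlt q (fun w => f (p ++ w)) := by
  intro u w a
  simpa using hf (p ++ u) w a

lemma IsAlt.cons {q : K} {f : List ℕ → M} (hf : IsAlt q f) (p : ℕ) :
    IsAlt q (fun w => f (p :: w)) := hf.append_left [p]

lemma IsAlt.append_right {q : K} {f : List ℕ → M} (hf : IsAlt q f) (p : List ℕ) :
    IsAlt q (fun w => f (w ++ p)) := by
  intro u w a
  simpa using hf u (w ++ p) a

lemma IsAlt.sub {q : K} {f g : List ℕ → M} (hf : IsAlt q f) (hg : IsAlt q g) :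
    IsAlt q (fun w => f w - g w) := by
  intro u w a
  refine ⟨by simp [(hf u w a).1, (hg u w a).1], fun b hb => ?_⟩
  simp only [(hf u w a).2 b hb, (hg u w a).2 b hb, smul_sub]
  abel

lemma IsAlt.exists_smul {q : K} (hq : q ≠ 0) {f : List ℕ → M} (hf : IsAlt q f)
    {w w' : List ℕ} (h : w.Perm w') : ∃ κ : K, f w' = κ • f w := by
  suffices ∀ p : List ℕ, ∃ κ : K, f (p ++ w') = κ • f (p ++ w) from this []
  induction h with
  | nil => exact fun p => ⟨1, by simp⟩
  | cons a _ ih => intro p; simpa using ih (p ++ [a])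
  | swap a b l =>
    intro p
    rcases lt_trichotomy a b with hab | rfl | hab
    · refine ⟨-q⁻¹, ?_⟩
      rw [(hf p l a).2 b hab]
      simp [smul_smul, hq]
    · exact ⟨1, by simp⟩
    · refine ⟨-q, ?_⟩
      rw [(hf p l b).2 a hab]
      simp
  | trans _ _ ih₁ ih₂ =>
    intro p
    obtain ⟨κ, hκ⟩ := ih₁ p
    obtain ⟨κ', hκ'⟩ := ih₂ p
    exact ⟨κ' * κ, by rw [hκ', hκ, smul_smul]⟩

lemma IsAlt.eq_zero_of_not_nodup {q : K} (hq : q ≠ 0) {f : List ℕ → M} (hf : IsAlt q f)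
    {w : List ℕ} (h : ¬ w.Nodup) : f w = 0 := by
  obtain ⟨a, ha⟩ : ∃ a, List.Duplicate a w := by
    by_contra! hc
    exact h (List.nodup_iff_forall_not_duplicate.2 hc)
  obtain ⟨l, hl⟩ := (List.duplicate_iff_sublist.1 ha).exists_perm_append
  obtain ⟨κ, hκ⟩ := hf.exists_smul hq hl.symm
  rw [hκ, show [a, a] ++ l = [] ++ a :: a :: l from rfl, (hf [] l a).1, smul_zero]

lemma IsAlt.eq_zero {q : K} (hq : q ≠ 0) {f : List ℕ → M} (hf : IsAlt q f)
    (h : ∀ L : Finset ℕ, f (L.sort (· ≤ ·)) = 0) (w : List ℕ) : f w = 0 := by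
  by_cases hw : w.Nodup
  · have hp : (w.toFinset.sort (· ≤ ·)).Perm w := by
      refine (List.perm_ext_iff_of_nodup (Finset.sort_nodup _ _) hw).2 ?_
      simp
    obtain ⟨κ, hκ⟩ := hf.exists_smul hq hp
    rw [hκ, h, smul_zero]
  · exact hf.eq_zero_of_not_nodup hq hw

lemma exch_exch_alt_right {q : K} (hq : q ≠ 0) (g : ℕ → ℕ → ℕ → M)
    (h0 : ∀ a d, g a d d = 0) (h1 : ∀ a d e, d < e → g a e d = -(q • g a d e)) (a c : ℕ) :
    exch q (fun a₂ d₂ => exch q (fun a₁ d₁ => g a₁ d₁ d₂) a₂ c) a c = 0 ∧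
    ∀ c', c < c' →
      exch q (fun a₂ d₂ => exch q (fun a₁ d₁ => g a₁ d₁ d₂) a₂ c') a c =
      -(q • exch q (fun a₂ d₂ => exch q (fun a₁ d₁ => g a₁ d₁ d₂) a₂ c) a c') := by
  constructor
  · rcases lt_trichotomy a c with h | rfl | h
    · simp [exch, h.ne, h, h0]
    · simp [exch, h0]
    · simp only [exch, h.ne', h.not_gt, h0, h1 _ _ _ h, if_true, if_false, lt_irrefl]
      match_scalars <;> field_simp <;> ring
  · intro c' hc
    rcases lt_trichotomy a c with h | rfl | h
    · have h' := h.trans hc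
      simp [exch, h.ne, h, h'.ne, h', h1 _ _ _ hc]
    · simp only [exch, hc.ne, hc.ne', hc.not_gt, hc, h0, h1 _ _ _ hc, if_true, if_false, lt_irrefl]
      match_scalars <;> field_simp
    · rcases lt_trichotomy a c' with h' | rfl | h'
      · simp only [exch, hc.ne, hc.ne', hc.not_gt, hc, h1 _ _ _ hc, if_true, if_false, h.ne',
          h.not_gt, h'.ne, h', h1 _ _ _ h, h1 _ _ _ h']
        match_scalars <;> field_simp
      · simp only [exch, hc.ne, hc.ne', hc.not_gt, hc, h0, h1 _ _ _ hc, if_true, if_false, lt_irrefl]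
        match_scalars <;> field_simp
      · simp only [exch, hc.ne, hc.ne', hc.not_gt, hc, h1 _ _ _ hc, if_true, if_false, h.ne',
          h.not_gt, h'.ne', h'.not_gt, h1 _ _ _ h, h1 _ _ _ h']
        match_scalars <;> field_simp <;> ring

lemma exch_exch_alt_left {q : K} (hq : q ≠ 0) (g : ℕ → ℕ → ℕ → M)
    (h0 : ∀ a d, g d d a = 0) (h1 : ∀ a d e, d < e → g e d a = -(q • g d e a)) (a c : ℕ) :
    exch q (fun a₁ c₁ => exch q (fun a₂ c₂ => g a₁ a₂ c₂) a c₁) a c = 0 ∧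
    ∀ a', a < a' →
      exch q (fun a₁ c₁ => exch q (fun a₂ c₂ => g a₁ a₂ c₂) a c₁) a' c =
      -(q • exch q (fun a₁ c₁ => exch q (fun a₂ c₂ => g a₁ a₂ c₂) a' c₁) a c) := by
  constructor
  · rcases lt_trichotomy c a with h | rfl | h
    · simp only [exch, h.ne', h.not_gt, h0, h1 _ _ _ h, if_true, if_false]
      match_scalars <;> field_simp <;> ring
    · simp [exch, h0]
    · simp [exch, h.ne, h, h0]
  · intro a' hc
    rcases lt_trichotomy c a with h | rfl | h
    · have h' := h.trans hc
      simp only [exch, h.ne', h.not_gt, h'.ne', h'.not_gt, hc.ne, hc.ne', hc, hc.not_gt,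
        h1 _ _ _ hc, h1 _ _ _ h, h1 _ _ _ h', if_true, if_false]
      match_scalars <;> field_simp <;> ring
    · simp only [exch, hc.ne', hc.ne, hc.not_gt, hc, h0, h1 _ _ _ hc, if_true, if_false]
      match_scalars <;> field_simp
    · rcases lt_trichotomy c a' with h' | rfl | h'
      · simp only [exch, hc.ne, hc.ne', hc.not_gt, hc, h1 _ _ _ hc, if_true, if_false,
          h.ne, h, h'.ne', h'.not_gt, h1 _ _ _ h, h1 _ _ _ h']
        match_scalars <;> field_simp
      · simp only [exch, hc.ne, hc.ne', hc.not_gt, hc, h0, h1 _ _ _ hc, if_true, if_false]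
        match_scalars <;> field_simp
      · simp [exch, h.ne, h, h'.ne, h', h1 _ _ _ hc]

lemma exchLetter_neg_smul (q k : K) (v : ℕ → List ℕ → M) (a : ℕ) (cs : List ℕ) :
    exchLetter q (fun a cs => -(k • v a cs)) a cs = -(k • exchLetter q v a cs) := by
  exact (map_exchLetter (-(LinearMap.lsmul K M k)) q v a cs).symm

lemma exchLetter_zero (q : K) (a : ℕ) (cs : List ℕ) :
    exchLetter q (fun _ _ => (0 : M)) a cs = 0 := by
  simpa using (map_exchLetter (0 : M →ₗ[K] M) q (fun _ _ => 0) a cs).symm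

lemma exchWord_neg_smul (q k : K) (v : List ℕ → List ℕ → M) (as cs : List ℕ) :
    exchWord q (fun as cs => -(k • v as cs)) as cs = -(k • exchWord q v as cs) := by
  exact (map_exchWord (-(LinearMap.lsmul K M k)) q v as cs).symm

lemma exchWord_zero (q : K) (as cs : List ℕ) :
    exchWord q (fun _ _ => (0 : M)) as cs = 0 := by
  simpa using (map_exchWord (0 : M →ₗ[K] M) q (fun _ _ => 0) as cs).symm

lemma IsAlt.exch {q : K} {v : ℕ → ℕ → List ℕ → M} (hv : ∀ a c, IsAlt q (v a c)) (a c : ℕ) :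
    IsAlt q (fun w => exch q (fun a c => v a c w) a c) := by
  intro u w x
  refine ⟨?_, fun y hy => ?_⟩
  · simp [QuantumMinor.exch, fun a c => (hv a c u w x).1]
  · simp only [QuantumMinor.exch, fun a c => (hv a c u w x).2 y hy]
    split_ifs <;> module

lemma IsAlt.exchLetter {q : K} (hq : q ≠ 0) {v : ℕ → List ℕ → M} (hv : ∀ a, IsAlt q (v a))
    (a : ℕ) : IsAlt q (fun cs => exchLetter q v a cs) := by
  intro u
  induction u generalizing v with
  | nil =>
    intro w c
    have key := fun a cs => exch_exch_alt_right hq (fun a d₁ d₂ => v a (d₁ :: d₂ :: cs))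
      (fun a d => (hv a [] cs d).1) (fun a d e h => (hv a [] cs d).2 e h) a
    simp only [List.nil_append, exchLetter_cons]
    refine ⟨?_, fun d hd => ?_⟩
    · simp only [fun a cs => (key a cs c).1, exchLetter_zero]
    · simp only [fun a cs => (key a cs c).2 d hd, exchLetter_neg_smul]
  | cons c u ih =>
    intro w d
    simp only [List.cons_append, exchLetter_cons]
    exact ih (fun a => IsAlt.exch (fun a c => (hv a).cons c) a c) w d

lemma IsAlt.exchWord_right {q : K} (hq : q ≠ 0) {v : List ℕ → List ℕ → M}
    (hv : ∀ as, IsAlt q (v as)) (as : List ℕ) : IsAlt q (fun cs => exchWord q v as cs) := by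
  induction as generalizing v with
  | nil => simpa only [exchWord_nil] using hv []
  | cons a as ih =>
    simp only [exchWord_cons]
    exact IsAlt.exchLetter hq (fun a' => ih (fun as' => hv (a' :: as'))) a

lemma exch_comm_exchLetter (q : K) (g : ℕ → ℕ → ℕ → List ℕ → M) (a c b : ℕ) (cs : List ℕ) :
    exch q (fun a c => exchLetter q (fun b w => g a c b w) b cs) a c =
      exchLetter q (fun b w => exch q (fun a c => g a c b w) a c) b cs := by
  simp only [exch]
  split_ifs
  · exact map_exchLetter (LinearMap.lsmul K M q) q (g a c) b cs
  · rfl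
  · have h := map_exchLetter ((LinearMap.proj (R := K) (φ := fun _ : Bool => M) true) +
      (q - q⁻¹) • (LinearMap.proj (R := K) (φ := fun _ : Bool => M) false)) q
      (fun b w i => if i then g a c b w else g c a b w) b cs
    simpa [exchLetter_apply] using h

lemma exchLetter_exchLetter_alt {q : K} (hq : q ≠ 0) (g : ℕ → ℕ → List ℕ → M)
    (h0 : ∀ a w, g a a w = 0) (h1 : ∀ a b w, a < b → g b a w = -(q • g a b w))
    (a : ℕ) (cs : List ℕ) :
    exchLetter q (fun a₁ w => exchLetter q (fun a₂ w' => g a₁ a₂ w') a w) a cs = 0 ∧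
    ∀ b, a < b →
      exchLetter q (fun a₁ w => exchLetter q (fun a₂ w' => g a₁ a₂ w') a w) b cs =
      -(q • exchLetter q (fun a₁ w => exchLetter q (fun a₂ w' => g a₁ a₂ w') b w) a cs) := by
  induction cs generalizing g with
  | nil => exact ⟨by simp [exchLetter_nil, h0], fun b hb => by simp [exchLetter_nil, h1 a b _ hb]⟩
  | cons c cs ih =>
    have step : ∀ x y, exchLetter q (fun a₁ w => exchLetter q (fun a₂ w' => g a₁ a₂ w') x w) y
        (c :: cs) = exchLetter q (fun a₁ w => exchLetter q (fun a₂ w' =>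
          exch q (fun a₁ c₁ => exch q (fun a₂ c₂ => g a₁ a₂ (c₂ :: w')) a₂ c₁) a₁ c) x w) y cs := by
      intro x y
      simp only [exchLetter_cons, exch_comm_exchLetter]
    have key := fun x w' => exch_exch_alt_left hq (fun a₁ a₂ c₂ => g a₁ a₂ (c₂ :: w'))
      (fun a d => h0 d _) (fun a d e h => h1 d e _ h) x c
    simp only [step]
    exact ih _ (fun x w' => (key x w').1) (fun x y w' h => (key x w').2 y h)

lemma IsAlt.exchWord_left {q : K} (hq : q ≠ 0) {v : List ℕ → List ℕ → M}
    (hv : ∀ cs, IsAlt q (fun as => v as cs)) (cs : List ℕ) :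
    IsAlt q (fun as => exchWord q v as cs) := by
  intro u
  induction u generalizing v cs with
  | nil =>
    intro w a
    simp only [List.nil_append, exchWord_cons]
    have key := exchLetter_exchLetter_alt hq
      (fun a₁ a₂ c => exchWord q (fun as c' => v (a₁ :: a₂ :: as) c') w c)
      (fun x c => by simp only [fun as c' => (hv c' [] as x).1, fun as c' => show
        v (x :: x :: as) c' = 0 from (hv c' [] as x).1, exchWord_zero])
      (fun x y c h => by simp only [fun as c' => show
        v (y :: x :: as) c' = -(q • v (x :: y :: as) c') from (hv c' [] as x).2 y h,
        exchWord_neg_smul])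
      a cs
    exact ⟨key.1, fun b hb => key.2 b hb⟩
  | cons a u ih =>
    intro w d
    simp only [List.cons_append, exchWord_cons]
    have key := fun a' c' => ih (v := fun as' c'' => v (a' :: as') c'')
      (fun cs => (hv cs).cons a') c' w d
    refine ⟨?_, fun e he => ?_⟩
    · simp only [fun a' c' => (key a' c').1, exchLetter_zero]
    · simp only [fun a' c' => (key a' c').2 e he, exchLetter_neg_smul]

lemma exchLetter_eq {q : K} {v : ℕ → List ℕ → M} {a : ℕ} {cs : List ℕ}
    (h : ∀ a' cs', (a' :: cs').Perm (a :: cs) → a' < a → v a' cs' = 0) :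
    exchLetter q v a cs = q ^ cs.count a • v a cs := by
  induction cs generalizing v with
  | nil => simp [exchLetter_nil]
  | cons c cs ih =>
    rw [exchLetter_cons, ih]
    · simp only [exch]
      rcases lt_trichotomy a c with hac | rfl | hac
      · simp [hac.ne, hac, List.count_cons, hac.ne']
      · simp [smul_smul, pow_succ]
      · rw [h c (a :: cs) (List.Perm.swap _ _ _) hac]
        simp [hac.ne', hac.not_gt, List.count_cons, hac.ne]
    · intro a' cs' hp hlt
      have h1 : v a' (c :: cs') = 0 := h _ _
        ((List.Perm.swap _ _ _).trans ((hp.cons c).trans (List.Perm.swap _ _ _))) hlt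
      simp only [exch]
      split_ifs with h2 h3
      · simp [h1]
      · exact h1
      · rw [h1, h c (a' :: cs') ((hp.cons c).trans (List.Perm.swap _ _ _)) (by omega)]
        simp

lemma exchWord_eq {q : K} {v : List ℕ → List ℕ → M} {as cs : List ℕ}
    (h : ∀ as' cs', as'.length = as.length → (as' ++ cs').Perm (as ++ cs) → as'.sum < as.sum →
      v as' cs' = 0) :
    exchWord q v as cs = q ^ (as.map (cs.count ·)).sum • v as cs := by
  induction as generalizing v cs with
  | nil => simp [exchWord_nil]
  | cons a as ih =>
    rw [exchWord_cons, exchLetter_eq]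
    · rw [ih]
      · simp [smul_smul, pow_add]
      · intro as' cs' hl hp hs
        exact h (a :: as') cs' (by simp [hl]) (hp.cons a) (by simpa using hs)
    · intro a' cs' hp hlt
      have hp' : ∀ l : List ℕ, (l ++ cs').Perm (as ++ cs') → (a' :: (l ++ cs')).Perm
          (a :: (as ++ cs)) := by
        intro l hl
        refine (hl.cons a').trans ?_
        refine (List.perm_middle.symm.trans ((hp.append_left as).trans List.perm_middle))
      rw [ih]
      · rw [h (a' :: as) cs' (by simp) (hp' as (List.Perm.refl _)) (by simpa using hlt), smul_zero]
      · intro as' cs'' hl hpp hs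
        refine h (a' :: as') cs'' (by simp [hl]) ?_ (by simp; omega)
        exact (hpp.cons a').trans (hp' as (List.Perm.refl _))

end Exchange

section Action

variable {K : Type*} [Field K] {A : Type*} [Ring A] [Algebra K A]

/-- Manin's relations for a matrix without restriction on the indices. -/
structure IsFullQMatrix (q : K) (x : ℕ → ℕ → A) : Prop where
  row : ∀ i {j k}, j < k → x i j * x i k = q • (x i k * x i j)
  col : ∀ j {i l}, i < l → x i j * x l j = q • (x l j * x i j)
  anti : ∀ {i l j k}, i < l → j < k → x i k * x l j = x l j * x i k
  diag : ∀ {i l j k}, i < l → j < k →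
    x i j * x l k = x l k * x i j + (q - q⁻¹) • (x i k * x l j)

lemma IsFullQMatrix.transpose {q : K} {x : ℕ → ℕ → A} (hx : IsFullQMatrix q x) :
    IsFullQMatrix q (fun i j => x j i) where
  row i _ _ h := hx.col i h
  col j _ _ h := hx.row j h
  anti h h' := (hx.anti h' h).symm
  diag h h' := by rw [hx.diag h' h, hx.anti h' h]

/-- The action of a row of the matrix `x`, with column indices in `U`. -/
def rowAct (K : Type*) [Field K] [Algebra K A] (x : ℕ → ℕ → A) (U : Finset ℕ) (a : ℕ) :
    (ℕ → A) →ₗ[K] A :=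
  ∑ b ∈ U, LinearMap.mulLeft K (x a b) ∘ₗ LinearMap.proj b

lemma rowAct_apply (x : ℕ → ℕ → A) (U : Finset ℕ) (a : ℕ) (f : ℕ → A) :
    rowAct K x U a f = ∑ b ∈ U, x a b * f b := by
  simp [rowAct]

/-- The action of the tensor power of the matrix `x` given by a word of row indices. -/
def wordAct (K : Type*) [Field K] [Algebra K A] (x : ℕ → ℕ → A) (U : Finset ℕ) :
    List ℕ → ((List ℕ → A) →ₗ[K] A)
  | [] => LinearMap.proj []
  | a :: as => ∑ b ∈ U, LinearMap.mulLeft K (x a b) ∘ₗ wordAct K x U as ∘ₗ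
      LinearMap.funLeft K A (fun w => b :: w)

lemma wordAct_nil (x : ℕ → ℕ → A) (U : Finset ℕ) (v : List ℕ → A) :
    wordAct K x U [] v = v [] := rfl

lemma wordAct_cons (x : ℕ → ℕ → A) (U : Finset ℕ) (a : ℕ) (as : List ℕ) (v : List ℕ → A) :
    wordAct K x U (a :: as) v = ∑ b ∈ U, x a b * wordAct K x U as (fun w => v (b :: w)) := by
  simp [wordAct, LinearMap.funLeft, Function.comp_def]

lemma wordAct_append (x : ℕ → ℕ → A) (U : Finset ℕ) (as bs : List ℕ) (v : List ℕ → A) :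
    wordAct K x U (as ++ bs) v =
      wordAct K x U as (fun r => wordAct K x U bs (fun s => v (r ++ s))) := by
  induction as generalizing v with
  | nil => simp [wordAct_nil]
  | cons a as ih => simp [wordAct_cons, ih]

lemma exch_eq {M : Type*} [AddCommGroup M] [Module K M] (q : K) (v : ℕ → ℕ → M) (a c : ℕ) :
    exch q v a c = (if a = c then q else 1) • v a c +
      (if c < a then q - q⁻¹ else 0) • v c a := by
  unfold exch
  rcases lt_trichotomy a c with h | rfl | h
  · simp [h.ne, h, h.not_gt]
  · simp
  · simp [h.ne', h, h.not_gt]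

lemma IsFullQMatrix.entries {q : K} {x : ℕ → ℕ → A} (hx : IsFullQMatrix q x) (hq : q ≠ 0) (a c b d : ℕ) :
    (if a = c then q else 1) • (x a b * x c d) +
      (if c < a then q - q⁻¹ else 0) • (x c b * x a d) =
    (if b = d then q else 1) • (x c d * x a b) +
      (if b < d then q - q⁻¹ else 0) • (x c b * x a d) := by
  rcases lt_trichotomy a c with h | rfl | h <;> rcases lt_trichotomy b d with h' | rfl | h'
  · simp [h.ne, h'.ne, h', h.not_gt, hx.diag h h', hx.anti h h']
  · simp [h.ne, h.not_gt, hx.col _ h]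
  · simp [h.ne, h'.ne', h.not_gt, h'.not_gt, hx.anti h h']
  · simp [h'.ne, h', hx.row _ h', smul_smul]
    match_scalars
    field_simp
    ring
  · simp
  · simp [h'.ne', h'.not_gt, hx.row _ h']
  · simp [h.ne', h'.ne, h, h', hx.anti h h']
  · simp [h.ne', h, hx.col _ h]
    match_scalars
    field_simp
    ring
  · simp [h.ne', h'.ne', h, h'.not_gt, hx.diag h h', hx.anti h h']

lemma IsFullQMatrix.exch_rowAct {q : K} {x : ℕ → ℕ → A} (hx : IsFullQMatrix q x)
    (hq : q ≠ 0) (U : Finset ℕ) (v : ℕ → ℕ → A) (a c : ℕ) :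
    exch q (fun a c => ∑ b ∈ U, x a b * ∑ d ∈ U, x c d * v b d) a c =
      ∑ d ∈ U, x c d * ∑ b ∈ U, x a b * exch q v b d := by
  have h : ∑ d ∈ U, x c d * ∑ b ∈ U, x a b * exch q v b d =
      ∑ b ∈ U, ∑ d ∈ U, ((if b = d then q else 1) • (x c d * x a b) +
        (if b < d then q - q⁻¹ else 0) • (x c b * x a d)) * v b d := by
    simp only [exch_eq, add_mul, Finset.sum_add_distrib, mul_add, Finset.mul_sum, smul_mul_assoc,
      mul_smul_comm, mul_assoc]
    congr 1
    exact Finset.sum_comm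
  rw [h, exch_eq]
  simp only [← hx.entries hq]
  simp only [add_mul, Finset.sum_add_distrib, Finset.mul_sum, smul_mul_assoc, Finset.smul_sum,
    mul_assoc]

lemma IsFullQMatrix.exchLetter_wordAct {q : K} {x : ℕ → ℕ → A} (hx : IsFullQMatrix q x)
    (hq : q ≠ 0) (U : Finset ℕ) (v : ℕ → List ℕ → A) (a : ℕ) (cs : List ℕ) :
    exchLetter q (fun a cs => ∑ b ∈ U, x a b * wordAct K x U cs (v b)) a cs =
      wordAct K x U cs (fun ds => ∑ b ∈ U, x a b * exchLetter q v b ds) := by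
  induction cs generalizing v with
  | nil => simp [exchLetter_nil, wordAct_nil]
  | cons c cs ih =>
    have h1 : ∀ b d cs', exch q (fun b d => wordAct K x U cs' (fun w => v b (d :: w))) b d =
        wordAct K x U cs' (fun w => exch q (fun b d => v b (d :: w)) b d) := by
      intro b d cs'
      rw [← map_exch]
      congr 1
      funext w
      rw [exch_apply]
    simp only [exchLetter_cons, wordAct_cons, hx.exch_rowAct hq, h1]
    have h2 := map_exchLetter (rowAct K x U c) q (fun a' cs' d => ∑ b ∈ U, x a' b *
      wordAct K x U cs' (fun w => exch q (fun b d => v b (d :: w)) b d)) a cs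
    simp only [rowAct_apply, exchLetter_apply] at h2
    rw [← h2]
    simp only [ih]

lemma IsFullQMatrix.exchWord_wordAct {q : K} {x : ℕ → ℕ → A} (hx : IsFullQMatrix q x)
    (hq : q ≠ 0) (U : Finset ℕ) (v : List ℕ → List ℕ → A) (as cs : List ℕ) :
    exchWord q (fun as cs => wordAct K x U as (fun bs => wordAct K x U cs (v bs))) as cs =
      wordAct K x U cs (fun ds => wordAct K x U as (fun bs => exchWord q v bs ds)) := by
  induction as generalizing v cs with
  | nil => simp [exchWord_nil, wordAct_nil]
  | cons a as ih =>
    have h1 : ∀ a' cs', exchWord q (fun as' cs'' => ∑ b ∈ U, x a' b *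
          wordAct K x U as' (fun bs => wordAct K x U cs'' (v (b :: bs)))) as cs' =
        ∑ b ∈ U, x a' b * wordAct K x U cs' (fun ds => wordAct K x U as
          (fun bs => exchWord q (fun bs => v (b :: bs)) bs ds)) := by
      intro a' cs'
      have h := map_exchWord (rowAct K x U a') q (fun as' cs'' b =>
        wordAct K x U as' (fun bs => wordAct K x U cs'' (v (b :: bs)))) as cs'
      simp only [rowAct_apply, exchWord_apply, ih] at h
      exact h.symm
    have h2 : ∀ b ds, exchLetter q (fun b ds => wordAct K x U as
          (fun bs => exchWord q (fun bs => v (b :: bs)) bs ds)) b ds =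
        wordAct K x U as (fun bs => exchWord q v (b :: bs) ds) := by
      intro b ds
      rw [← map_exchLetter]
      congr 1
      funext bs
      rw [exchLetter_apply, exchWord_cons]
    simp only [exchWord_cons, wordAct_cons, h1, hx.exchLetter_wordAct hq, h2]

lemma sum_sum_eq_zero_of_antisymm {M : Type*} [AddCommGroup M] (U : Finset ℕ) (F : ℕ → ℕ → M)
    (h0 : ∀ b, F b b = 0) (h1 : ∀ b d, b < d → F b d + F d b = 0) :
    ∑ b ∈ U, ∑ d ∈ U, F b d = 0 := by
  rw [← Finset.sum_product']
  refine Finset.sum_involution (fun p _ => p.swap) ?_ ?_ ?_ ?_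
  · rintro ⟨b, d⟩ -
    rcases lt_trichotomy b d with h | rfl | h
    · exact h1 b d h
    · simp [h0]
    · rw [add_comm]
      exact h1 d b h
  · rintro ⟨b, d⟩ - h h'
    obtain rfl : d = b := congrArg Prod.fst h'
    exact h (h0 _)
  · simp +contextual
  · simp

lemma IsAlt.wordAct {q : K} {x : ℕ → ℕ → A} (hx : IsFullQMatrix q x) (hq : q ≠ 0) (U : Finset ℕ)
    {v : List ℕ → A} (hv : IsAlt q v) : IsAlt q (fun as => wordAct K x U as v) := by
  intro u w a
  induction u generalizing v with
  | nil =>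
    simp only [List.nil_append, wordAct_cons, Finset.mul_sum, ← mul_assoc]
    have g0 : ∀ b, QuantumMinor.wordAct K x U w (fun w => v (b :: b :: w)) = 0 := by
      intro b
      rw [show (fun w => v (b :: b :: w)) = 0 from funext fun w => (hv [] w b).1, map_zero]
    have g1 : ∀ b d, b < d → QuantumMinor.wordAct K x U w (fun w => v (d :: b :: w)) =
        -(q • QuantumMinor.wordAct K x U w (fun w => v (b :: d :: w))) := by
      intro b d h
      rw [show (fun w => v (d :: b :: w)) = -(q • fun w => v (b :: d :: w)) from
        funext fun w => (hv [] w b).2 d h, map_neg, map_smul]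
    refine ⟨sum_sum_eq_zero_of_antisymm U _ (fun b => ?_) (fun b d h => ?_), fun c hc => ?_⟩
    · rw [g0, mul_zero]
    · rw [g1 b d h, hx.row _ h]
      simp
    · rw [← sub_eq_zero, sub_neg_eq_add, Finset.smul_sum, ← Finset.sum_add_distrib]
      simp only [Finset.smul_sum, ← Finset.sum_add_distrib]
      refine sum_sum_eq_zero_of_antisymm U _ (fun b => ?_) (fun b d h => ?_)
      · simp [g0]
      · rw [g1 b d h, hx.diag hc h, ← hx.anti hc h]
        simp only [add_mul, smul_mul_assoc, mul_neg, mul_smul_comm]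
        match_scalars <;> field_simp <;> ring
  | cons b u ih =>
    simp only [List.cons_append, wordAct_cons]
    refine ⟨Finset.sum_eq_zero fun d _ => ?_, fun c hc => ?_⟩
    · have := (ih (hv.cons d)).1
      simp only at this
      rw [this, mul_zero]
    · simp only [fun d => (ih (hv.cons d)).2 c hc, Finset.smul_sum, mul_neg, mul_smul_comm,
        Finset.sum_neg_distrib]

/-- The number of inversions of a word. -/
def inversions : List ℕ → ℕ
  | [] => 0
  | b :: w => w.countP (· < b) + inversions w

lemma inversions_swap (u w : List ℕ) {a b : ℕ} (h : a < b) :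
    inversions (u ++ b :: a :: w) = inversions (u ++ a :: b :: w) + 1 := by
  induction u with
  | nil => simp [inversions, h, h.not_gt]; omega
  | cons c u ih => simp [inversions, ih, List.countP_cons]; omega

lemma countP_ofFn (p : ℕ → Prop) [DecidablePred p] {k : ℕ} (g : Fin k → ℕ) :
    (List.ofFn g).countP p = ∑ i, if p (g i) then 1 else 0 := by
  induction k with
  | zero => simp
  | succ k ih =>
    rw [List.ofFn_succ, List.countP_cons, ih, Fin.sum_univ_succ, add_comm]
    simp

lemma inversions_ofFn {k : ℕ} (g : Fin k → ℕ) : inversions (List.ofFn g) =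
    (Finset.univ.filter (fun p : Fin k × Fin k => p.1 < p.2 ∧ g p.2 < g p.1)).card := by
  induction k with
  | zero => simp [inversions]
  | succ k ih =>
    rw [List.ofFn_succ, inversions, ih, Finset.card_filter, Finset.card_filter,
      Fintype.sum_prod_type, Fintype.sum_prod_type, Fin.sum_univ_succ]
    simp only [Fin.sum_univ_succ, lt_irrefl, false_and, if_false, zero_add,
      Fin.succ_pos, true_and, Fin.not_lt_zero, Fin.succ_lt_succ_iff]
    congr 1
    exact countP_ofFn _ _

/-- The coordinate vector of the quantum exterior product of the basis vectors in `J`. -/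
def altVec (q : K) (J : Finset ℕ) (w : List ℕ) : K :=
  if w.Perm (J.sort (· ≤ ·)) then (-q) ^ inversions w else 0

lemma altVec_eq_zero {q : K} {J : Finset ℕ} {w : List ℕ} (h : ¬ w.Perm (J.sort (· ≤ ·))) :
    altVec q J w = 0 := if_neg h

lemma isAlt_altVec (q : K) (J : Finset ℕ) : IsAlt q (altVec q J) := by
  intro u w a
  refine ⟨altVec_eq_zero fun h => ?_, fun b hb => ?_⟩
  · have := h.nodup_iff.2 (J.sort_nodup _)
    simp [List.nodup_append] at this
  · have h : (u ++ b :: a :: w).Perm (u ++ a :: b :: w) := (List.Perm.swap _ _ _).append_left u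
    simp only [altVec, h.congr_left, inversions_swap u w hb]
    split_ifs <;> simp [pow_succ, mul_comm]

lemma inversions_sort (J : Finset ℕ) : inversions (J.sort (· ≤ ·)) = 0 := by
  have h : ∀ w : List ℕ, w.Pairwise (· ≤ ·) → inversions w = 0 := by
    intro w hw
    induction hw with
    | nil => rfl
    | cons h _ ih => simpa [inversions, ih] using h
  exact h _ (J.pairwise_sort _)

lemma altVec_sort (q : K) (J : Finset ℕ) : altVec q J (J.sort (· ≤ ·)) = 1 := by
  simp [altVec, inversions_sort]

lemma wordAct_ofFn (x : ℕ → ℕ → A) (U : Finset ℕ) {k : ℕ} (f : Fin k → ℕ) (v : List ℕ → A) :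
    wordAct K x U (List.ofFn f) v = ∑ g : Fin k → U,
      (List.ofFn fun d => x (f d) (g d)).prod * v (List.ofFn fun d => (g d : ℕ)) := by
  induction k generalizing v with
  | zero => simp [wordAct_nil]
  | succ k ih =>
    rw [List.ofFn_succ, wordAct_cons, ← (Fin.consEquiv fun _ => U).sum_comp,
      Fintype.sum_prod_type, ← Finset.sum_coe_sort U]
    refine Finset.sum_congr rfl fun b _ => ?_
    rw [ih, Finset.mul_sum]
    refine Finset.sum_congr rfl fun g _ => ?_
    simp [List.ofFn_succ, Fin.consEquiv, mul_assoc]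

/-- The vector of scalars `e`, seen in the algebra `A`. -/
def scalarVec (A : Type*) [Ring A] [Algebra K A] (e : List ℕ → K) (w : List ℕ) : A :=
  algebraMap K A (e w)

end Action

lemma sort_eq_ofFn (I : Finset ℕ) {k : ℕ} (h : I.card = k) :
    I.sort (· ≤ ·) = List.ofFn (I.orderEmbOfFin h) := by
  refine List.ext_getElem (by simp [h]) fun i h1 h2 => ?_
  simp [Finset.orderEmbOfFin_apply]

section Minor

variable {K : Type} [Field K] {A : Type} [Ring A] [Algebra K A]

lemma qMinor_eq_sum (q : K) (x : ℕ → ℕ → A) {I J : Finset ℕ} {k : ℕ} (hI : I.card = k)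
    (hJ : J.card = k) : qMinor q x I J = ∑ σ : Equiv.Perm (Fin k), (-q) ^ permInversions σ •
      (List.ofFn fun d => x (I.orderEmbOfFin hI d) (J.orderEmbOfFin hJ (σ d))).prod := by
  subst hI
  rw [qMinor, dif_pos hJ.symm]

lemma permInversions_eq (J : Finset ℕ) {k : ℕ} (h : J.card = k) (σ : Equiv.Perm (Fin k)) :
    inversions (List.ofFn fun d => J.orderEmbOfFin h (σ d)) = permInversions σ := by
  simp [inversions_ofFn, permInversions]

lemma permInversions_inv {k : ℕ} (σ : Equiv.Perm (Fin k)) :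
    permInversions σ⁻¹ = permInversions σ := by
  refine Finset.card_nbij' (fun p => (σ⁻¹ p.2, σ⁻¹ p.1)) (fun p => (σ p.2, σ p.1)) ?_ ?_ ?_ ?_ <;>
  simp +contextual [Set.MapsTo, Set.LeftInvOn]

lemma qMinor_eq_wordAct (q : K) (x : ℕ → ℕ → A) {U I J : Finset ℕ} (hJU : J ⊆ U)
    (hIJ : I.card = J.card) :
    qMinor q x I J = wordAct K x U (I.sort (· ≤ ·)) (scalarVec A (altVec q J)) := by
  rw [sort_eq_ofFn I hIJ, wordAct_ofFn, qMinor_eq_sum q x hIJ rfl]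
  have hmem : ∀ d, J.orderEmbOfFin rfl d ∈ U := fun d => hJU (J.orderEmbOfFin_mem rfl d)
  refine Finset.sum_of_injOn (fun σ d => ⟨J.orderEmbOfFin rfl (σ d), hmem _⟩) ?_ ?_ ?_ ?_
  · intro σ _ τ _ h
    ext d
    have : σ d = τ d := by simpa using congrFun h d
    rw [this]
  · simp [Set.MapsTo]
  · intro g _ hg
    suffices h : altVec q J (List.ofFn fun d => (g d : ℕ)) = 0 by simp [scalarVec, h]
    refine altVec_eq_zero fun hp => hg ?_
    have hJ : ∀ d, (g d : ℕ) ∈ J := fun d => by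
      have : (g d : ℕ) ∈ J.sort (· ≤ ·) := hp.subset (List.mem_ofFn.2 ⟨d, rfl⟩)
      simpa using this
    have hinj : Function.Injective fun d => (g d : ℕ) :=
      List.nodup_ofFn.1 (hp.nodup_iff.2 (J.sort_nodup _))
    let τ : Fin J.card → Fin J.card := fun d => (J.orderIsoOfFin rfl).symm ⟨g d, hJ d⟩
    have hτ : Function.Injective τ := fun d e h => hinj (by simpa [τ] using h)
    refine ⟨Equiv.ofBijective τ (Finite.injective_iff_bijective.1 hτ), by simp, ?_⟩
    funext d
    apply Subtype.ext
    simp [τ, ← Finset.coe_orderIsoOfFin_apply]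
  · intro σ _
    have hp : (List.ofFn fun d => J.orderEmbOfFin rfl (σ d)).Perm (J.sort (· ≤ ·)) := by
      rw [sort_eq_ofFn J rfl]
      exact Equiv.Perm.ofFn_comp_perm σ _
    simp only [scalarVec, altVec, if_pos hp, permInversions_eq, Algebra.algebraMap_eq_smul_one,
      mul_smul_comm, mul_one]

lemma IsFullQMatrix.prod_eq_of_perm {q : K} {x : ℕ → ℕ → A} (hx : IsFullQMatrix q x)
    {l₁ l₂ : List (ℕ × ℕ)} (h : l₁.Perm l₂) (h₁ : l₁.Pairwise (fun p r => p.1 < r.1))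
    (h₂ : l₂.Pairwise (fun p r => p.2 < r.2)) :
    (l₁.map fun p => x p.1 p.2).prod = (l₂.map fun p => x p.1 p.2).prod := by
  induction l₂ generalizing l₁ with
  | nil => simp [h.eq_nil]
  | cons p l₂ ih =>
    obtain ⟨s, t, rfl⟩ := List.append_of_mem (h.symm.subset List.mem_cons_self)
    have hp : (s ++ t).Perm l₂ := (List.perm_middle.symm.trans h).cons_inv
    rw [List.pairwise_cons] at h₂
    have hst : (s ++ t).Pairwise (fun p r => p.1 < r.1) :=
      h₁.sublist ((List.sublist_cons_self p t).append_left s)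
    have hc : Commute (s.map fun p => x p.1 p.2).prod (x p.1 p.2) := by
      refine (Commute.list_prod_left _ _ ?_)
      intro y hy
      obtain ⟨r, hr, rfl⟩ := List.mem_map.1 hy
      exact hx.anti ((List.pairwise_append.1 h₁).2.2 r hr p List.mem_cons_self)
        (h₂.1 r (hp.subset (List.mem_append_left t hr)))
    rw [List.map_cons, List.prod_cons, ← ih hp hst h₂.2, List.map_append, List.map_append,
      List.prod_append, List.prod_append, List.map_cons, List.prod_cons, ← mul_assoc, hc.eq,
      mul_assoc]

lemma IsFullQMatrix.qMinor_transpose {q : K} {x : ℕ → ℕ → A} (hx : IsFullQMatrix q x)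
    {I J : Finset ℕ} (hIJ : I.card = J.card) :
    qMinor q (fun i j => x j i) J I = qMinor q x I J := by
  rw [qMinor_eq_sum q _ rfl hIJ, qMinor_eq_sum q _ hIJ rfl,
    ← Equiv.sum_comp (Equiv.inv (Equiv.Perm (Fin J.card)))]
  refine Finset.sum_congr rfl fun σ _ => ?_
  rw [Equiv.inv_apply, permInversions_inv]
  congr 1
  have h := hx.prod_eq_of_perm
    (l₁ := List.ofFn fun d => (I.orderEmbOfFin hIJ d, J.orderEmbOfFin rfl (σ d)))
    (l₂ := List.ofFn fun d => (I.orderEmbOfFin hIJ (σ⁻¹ d), J.orderEmbOfFin rfl d)) ?_ ?_ ?_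
  · simpa [List.map_ofFn, Function.comp_def] using h.symm
  · have := Equiv.Perm.ofFn_comp_perm σ
      (fun d => (I.orderEmbOfFin hIJ (σ⁻¹ d), J.orderEmbOfFin rfl d))
    simpa [Function.comp_def] using this
  · simp [List.pairwise_ofFn]
  · simp [List.pairwise_ofFn]

end Minor

lemma sum_le_sum_of_finsetLT {I I' : Finset ℕ} (h : finsetLT (I \ I') (I' \ I)) {as cs : List ℕ}
    (has : as.Nodup) (hcs : cs.Nodup) (hl : as.length = I.card)
    (hp : (as ++ cs).Perm (I.sort (· ≤ ·) ++ I'.sort (· ≤ ·))) :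
    (I.sort (· ≤ ·)).sum ≤ as.sum := by
  have hcount : ∀ a, as.count a + cs.count a =
      (I.sort (· ≤ ·)).count a + (I'.sort (· ≤ ·)).count a := by
    intro a
    rw [← List.count_append, ← List.count_append, hp.count_eq]
  have hmem : ∀ a, ((if a ∈ as then 1 else 0) + if a ∈ cs then 1 else 0) =
      ((if a ∈ I then 1 else 0) + if a ∈ I' then 1 else 0 : ℕ) := by
    intro a
    have := hcount a
    rw [has.count, hcs.count, (I.sort_nodup _).count, (I'.sort_nodup _).count] at this
    simpa using this
  have hI : (I.sort (· ≤ ·)).sum = ∑ a ∈ I, a := by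
    simpa using (List.sum_toFinset (fun a => a) (I.sort_nodup (· ≤ ·))).symm
  have hA : as.sum = ∑ a ∈ as.toFinset, a := by
    rw [List.sum_toFinset _ has, List.map_id']
  have hcard : as.toFinset.card = I.card := by rw [List.toFinset_card_of_nodup has, hl]
  rw [hI, hA, ← Finset.sum_sdiff_le_sum_sdiff]
  have hlt : ∀ a ∈ I \ as.toFinset, ∀ b ∈ as.toFinset \ I, a ≤ b := by
    intro a ha b hb
    simp only [Finset.mem_sdiff, List.mem_toFinset] at ha hb
    have h1 := hmem a
    have h2 := hmem b
    refine (h a ?_ b ?_).le <;> simp only [Finset.mem_sdiff]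
    · refine ⟨ha.1, fun h' => ?_⟩
      simp only [ha, h', if_true, if_false] at h1
      split_ifs at h1 <;> omega
    · refine ⟨?_, hb.2⟩
      by_contra h'
      simp only [hb, h', if_true, if_false] at h2
      split_ifs at h2 <;> omega
  have hc := Finset.card_sdiff_comm hcard
  have hN : ∀ a ∈ I \ as.toFinset, a ≤ (I \ as.toFinset).sup id := fun a ha =>
    Finset.le_sup (f := id) ha
  refine (Finset.sum_le_card_nsmul _ _ _ hN).trans ?_
  rw [← hc]
  exact Finset.card_nsmul_le_sum _ _ _ fun b hb => Finset.sup_le fun a ha => hlt a ha b hb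

lemma sum_map_count_sort (I I' : Finset ℕ) :
    ((I.sort (· ≤ ·)).map ((I'.sort (· ≤ ·)).count ·)).sum = (I ∩ I').card := by
  have h : ∀ a, (I'.sort (· ≤ ·)).count a = if a ∈ I' then 1 else 0 := by
    intro a
    rw [(I'.sort_nodup _).count]
    simp
  have h' := List.sum_toFinset (fun a => if a ∈ I' then 1 else 0) (I.sort_nodup (· ≤ ·))
  rw [Finset.sort_toFinset] at h'
  simp only [h]
  rw [← h', ← Finset.filter_mem_eq_inter, Finset.card_filter]

section Exchange

variable {K : Type*} [Field K] {A : Type*} [Ring A] [Algebra K A] {q : K} {x : ℕ → ℕ → A}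

lemma wordAct_mul_right (x : ℕ → ℕ → A) (U : Finset ℕ) (as : List ℕ) (v : List ℕ → A) (y : A) :
    wordAct K x U as (fun w => v w * y) = wordAct K x U as v * y := by
  induction as generalizing v with
  | nil => simp [wordAct_nil]
  | cons a as ih => simp [wordAct_cons, ih, Finset.sum_mul, mul_assoc]

lemma wordAct_algebraMap_mul (x : ℕ → ℕ → A) (U : Finset ℕ) (as : List ℕ) (v : List ℕ → A)
    (k : K) : wordAct K x U as (fun w => algebraMap K A k * v w) =
      algebraMap K A k * wordAct K x U as v := by
  have := map_smul (wordAct K x U as) k v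
  rw [← Algebra.smul_def, ← this]
  congr 1
  funext w
  simp [Algebra.smul_def]

lemma IsAlt.scalarVec {e : List ℕ → K} (he : IsAlt q e) : IsAlt q (scalarVec A e) :=
  he.map (Algebra.linearMap K A)

lemma IsFullQMatrix.exchWord_mul (hx : IsFullQMatrix q x) (hq : q ≠ 0) (U : Finset ℕ)
    (e f : List ℕ → K) (as cs : List ℕ) :
    exchWord q (fun as cs => wordAct K x U as (scalarVec A e) * wordAct K x U cs (scalarVec A f))
      as cs = wordAct K x U cs (fun ds => wordAct K x U as (fun bs =>
        algebraMap K A (exchWord q (fun bs ds => e bs * f ds) bs ds))) := by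
  have h := hx.exchWord_wordAct hq U (fun bs ds => algebraMap K A (e bs * f ds)) as cs
  have h' : ∀ bs ds, exchWord q (fun bs ds => algebraMap K A (e bs * f ds)) bs ds =
      algebraMap K A (exchWord q (fun bs ds => e bs * f ds) bs ds) := fun bs ds =>
    (map_exchWord (Algebra.linearMap K A) q _ bs ds).symm
  simp only [h'] at h
  rw [← h]
  congr 1
  funext as cs
  rw [← wordAct_mul_right]
  congr 1
  funext bs
  simp only [map_mul]
  rw [wordAct_algebraMap_mul]
  rfl

lemma IsFullQMatrix.exchWord_rows (hx : IsFullQMatrix q x) (hq : q ≠ 0) (U : Finset ℕ)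
    {e f : List ℕ → K} (he : IsAlt q e) (hf : IsAlt q f) {I I' : Finset ℕ}
    (h : finsetLT (I \ I') (I' \ I)) :
    q ^ (I ∩ I').card • (wordAct K x U (I.sort (· ≤ ·)) (scalarVec A e) *
      wordAct K x U (I'.sort (· ≤ ·)) (scalarVec A f)) =
    wordAct K x U (I'.sort (· ≤ ·)) (fun ds => wordAct K x U (I.sort (· ≤ ·)) (fun bs =>
        algebraMap K A (exchWord q (fun bs ds => e bs * f ds) bs ds))) := by
  rw [← hx.exchWord_mul hq, exchWord_eq, sum_map_count_sort]
  intro as cs hl hp hs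
  by_cases has : as.Nodup
  · by_cases hcs : cs.Nodup
    · exact absurd (sum_le_sum_of_finsetLT h has hcs (by simpa using hl) hp) (by omega)
    · rw [(IsAlt.wordAct hx hq U hf.scalarVec).eq_zero_of_not_nodup hq hcs, mul_zero]
  · rw [(IsAlt.wordAct hx hq U he.scalarVec).eq_zero_of_not_nodup hq has, zero_mul]

lemma IsAlt.exchWord_mul_left (hq : q ≠ 0) {e : List ℕ → K} (he : IsAlt q e) (f : List ℕ → K)
    (cs : List ℕ) : IsAlt q (fun as => exchWord q (fun as cs => e as * f cs) as cs) :=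
  IsAlt.exchWord_left hq (fun cs => he.map (LinearMap.mulRight K (f cs))) cs

lemma IsAlt.exchWord_mul_right (hq : q ≠ 0) (e : List ℕ → K) {f : List ℕ → K} (hf : IsAlt q f)
    (as : List ℕ) : IsAlt q (fun cs => exchWord q (fun as cs => e as * f cs) as cs) :=
  IsAlt.exchWord_right hq (fun as => hf.map (LinearMap.mulLeft K (e as))) as

lemma altVec_mul_altVec_ne_zero {J J' : Finset ℕ} {as cs : List ℕ}
    (h : altVec q J as * altVec q J' cs ≠ 0) :
    as.Perm (J.sort (· ≤ ·)) ∧ cs.Perm (J'.sort (· ≤ ·)) := by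
  constructor <;> by_contra h' <;> exact h (by simp [altVec_eq_zero h'])

lemma sort_perm_sort {I J : Finset ℕ} : (I.sort (· ≤ ·)).Perm (J.sort (· ≤ ·)) ↔ I = J := by
  refine ⟨fun h => ?_, fun h => h ▸ List.Perm.refl _⟩
  ext a
  simpa using h.mem_iff (a := a)

lemma exchWord_altVec (hq : q ≠ 0) {J J' : Finset ℕ} (h : finsetLT (J' \ J) (J \ J'))
    (as cs : List ℕ) :
    exchWord q (fun as cs => altVec q J as * altVec q J' cs) as cs =
      q ^ (J ∩ J').card * (altVec q J as * altVec q J' cs) := by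
  rw [← sub_eq_zero]
  refine IsAlt.eq_zero hq (f := fun as => _ - _) (((isAlt_altVec q J).exchWord_mul_left hq _ cs).sub
    (((isAlt_altVec q J).map (LinearMap.mulRight K (altVec q J' cs))).map
      (LinearMap.mulLeft K (q ^ (J ∩ J').card)))) (fun L => ?_) as
  refine IsAlt.eq_zero hq (f := fun cs => _ - _) (((isAlt_altVec q J').exchWord_mul_right hq _ _).sub
    (((isAlt_altVec q J').map (LinearMap.mulLeft K (altVec q J (L.sort (· ≤ ·))))).map
      (LinearMap.mulLeft K (q ^ (J ∩ J').card)))) (fun L' => ?_) cs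
  simp only [LinearMap.mulLeft_apply]
  rw [exchWord_eq, sum_map_count_sort, sub_eq_zero, smul_eq_mul]
  · by_cases h0 : altVec q J (L.sort (· ≤ ·)) * altVec q J' (L'.sort (· ≤ ·)) = 0
    · rw [h0, mul_zero, mul_zero]
    · obtain ⟨h1, h2⟩ := altVec_mul_altVec_ne_zero h0
      rw [sort_perm_sort.1 h1, sort_perm_sort.1 h2]
  · intro as' cs' hl hp hs
    by_contra h0
    obtain ⟨h1, h2⟩ := altVec_mul_altVec_ne_zero h0
    have hp' : (L'.sort (· ≤ ·) ++ L.sort (· ≤ ·)).Perm (J'.sort (· ≤ ·) ++ J.sort (· ≤ ·)) :=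
      List.perm_append_comm.trans (hp.symm.trans ((h1.append h2).trans List.perm_append_comm))
    have h3 := sum_le_sum_of_finsetLT h (L'.sort_nodup _) (L.sort_nodup _)
      (by
        have e1 := hp'.length_eq
        have e2 := h1.length_eq
        simp only [List.length_append, Finset.length_sort] at e1 e2 hl ⊢
        omega) hp'
    have h4 := hp'.sum_eq
    have h5 := h1.sum_eq
    simp only [List.sum_append] at h4
    omega

end Exchange

section Quasicommutation

variable {K : Type} [Field K] {A : Type} [Ring A] [Algebra K A] {q : K} {x : ℕ → ℕ → A}

lemma IsFullQMatrix.qMinor_mul_of_finsetLT (hx : IsFullQMatrix q x) (hq : q ≠ 0)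
    {I J I' J' : Finset ℕ} (hIJ : I.card = J.card) (hIJ' : I'.card = J'.card)
    (hI : finsetLT (I \ I') (I' \ I)) (hJ : finsetLT (J' \ J) (J \ J')) :
    q ^ (I ∩ I').card • (qMinor q x I J * qMinor q x I' J') =
      q ^ (J ∩ J').card • (qMinor q x I' J' * qMinor q x I J) := by
  rw [qMinor_eq_wordAct q x (Finset.subset_union_left (s₂ := J')) hIJ,
    qMinor_eq_wordAct q x (Finset.subset_union_right (s₁ := J)) hIJ',
    hx.exchWord_rows hq _ (isAlt_altVec q J) (isAlt_altVec q J') hI]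
  simp only [exchWord_altVec hq hJ]
  rw [← wordAct_mul_right, ← map_smul]
  congr 1
  funext ds
  simp only [Pi.smul_apply, map_mul]
  rw [wordAct_algebraMap_mul, wordAct_mul_right, ← Algebra.smul_def, ← Algebra.commutes]
  rfl

lemma altVec_singleton (q : K) (j d : ℕ) : altVec q {j} [d] = if d = j then 1 else 0 := by
  simp [altVec, inversions]

lemma wordAct_singleton {U : Finset ℕ} {j : ℕ} (hj : j ∈ U) (i : ℕ) :
    wordAct K x U [i] (scalarVec A (altVec q {j})) = x i j := by
  simp [wordAct_cons, wordAct_nil, scalarVec, altVec_singleton, hj, apply_ite]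

lemma IsFullQMatrix.qMinor_comm_entry (hx : IsFullQMatrix q x) (hq : q ≠ 0)
    {I J : Finset ℕ} (hIJ : I.card = J.card) {i j : ℕ} (hi : i ∈ I) (hj : j ∈ J) :
    qMinor q x I J * x i j = x i j * qMinor q x I J := by
  have hij : qMinor q x {i} {j} = x i j := by
    rw [qMinor_eq_wordAct q x (Finset.Subset.refl {j}) (by simp), Finset.sort_singleton,
      wordAct_singleton (by simp)]
  have h := hx.qMinor_mul_of_finsetLT hq hIJ (I' := {i}) (J' := {j}) (by simp)
    (by simp [finsetLT, Finset.sdiff_singleton_eq_erase, hi]) (by simp [finsetLT, hj])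
  rw [Finset.inter_singleton_of_mem hi, Finset.inter_singleton_of_mem hj, hij] at h
  simpa [hq] using h

lemma exchWord_altVec_singleton_right (hq : q ≠ 0) {J : Finset ℕ} {j : ℕ} (hj : j ∉ J) {d : ℕ}
    (hd : ¬ (d ∈ J ∧ d < j)) (bs : List ℕ) :
    exchWord q (fun as cs => altVec q J as * altVec q {j} cs) bs [d] =
      if d = j then altVec q J bs else 0 := by
  suffices ∀ bs, exchWord q (fun as cs => altVec q J as * altVec q {j} cs) bs [d] -
      (if d = j then (1 : K) else 0) * altVec q J bs = 0 by
    rw [sub_eq_zero.1 (this bs)]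
    split_ifs <;> simp
  refine IsAlt.eq_zero hq (((isAlt_altVec q J).exchWord_mul_left hq _ [d]).sub
    ((isAlt_altVec q J).map (LinearMap.mulLeft K (if d = j then (1 : K) else 0)))) (fun L => ?_)
  rw [exchWord_eq, sub_eq_zero, smul_eq_mul, altVec_singleton, mul_comm (altVec _ _ _)]
  · split_ifs with h
    · by_cases h0 : altVec q J (L.sort (· ≤ ·)) = 0
      · simp [h0]
      · obtain rfl : L = J := sort_perm_sort.1 (by_contra fun h' => h0 (altVec_eq_zero h'))
        rw [← Finset.sort_singleton (r := (· ≤ ·)), sum_map_count_sort]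
        simp [h, hj]
    · simp
  · intro as' cs' hl hp hs
    by_contra h0
    obtain ⟨h1, h2⟩ := altVec_mul_altVec_ne_zero h0
    have hp' := (h1.append h2).symm.trans hp
    have h4 := hp'.sum_eq
    have h5 := h1.sum_eq
    have h6 := hp'.symm.subset (a := d) (by simp)
    simp only [List.sum_append, Finset.sort_singleton, List.sum_singleton, List.mem_append,
      Finset.mem_sort, List.mem_singleton] at h4 h6
    rcases h6 with h6 | h6
    · exact hd ⟨h6, by omega⟩
    · omega

lemma exchWord_altVec_singleton_left (hq : q ≠ 0) {J : Finset ℕ} {j : ℕ} (hj : j ∉ J) {d : ℕ}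
    (hd : ¬ (d ∈ J ∧ j < d)) (ds : List ℕ) :
    exchWord q (fun as cs => altVec q {j} as * altVec q J cs) [d] ds =
      if d = j then altVec q J ds else 0 := by
  suffices ∀ ds, exchWord q (fun as cs => altVec q {j} as * altVec q J cs) [d] ds -
      (if d = j then (1 : K) else 0) * altVec q J ds = 0 by
    rw [sub_eq_zero.1 (this ds)]
    split_ifs <;> simp
  refine IsAlt.eq_zero hq (((isAlt_altVec q J).exchWord_mul_right hq _ [d]).sub
    ((isAlt_altVec q J).map (LinearMap.mulLeft K (if d = j then (1 : K) else 0)))) (fun L => ?_)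
  rw [exchWord_eq, sub_eq_zero, smul_eq_mul, altVec_singleton]
  · split_ifs with h
    · by_cases h0 : altVec q J (L.sort (· ≤ ·)) = 0
      · simp [h0]
      · obtain rfl : L = J := sort_perm_sort.1 (by_contra fun h' => h0 (altVec_eq_zero h'))
        rw [← Finset.sort_singleton (r := (· ≤ ·)), sum_map_count_sort]
        simp [h, hj]
    · simp
  · intro as' cs' hl hp hs
    by_contra h0
    obtain ⟨h1, h2⟩ := altVec_mul_altVec_ne_zero h0
    have hp' := (h1.append h2).symm.trans hp
    have h5 := h1.sum_eq
    have h6 := hp'.symm.subset (a := d) (by simp)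
    simp only [Finset.sort_singleton, List.sum_singleton, List.mem_append,
      Finset.mem_sort, List.mem_singleton] at h5 h6 hs
    rcases h6 with h6 | h6
    · omega
    · exact hd ⟨h6, by omega⟩

lemma IsFullQMatrix.exists_qMinor_mul_entry (hx : IsFullQMatrix q x) (hq : q ≠ 0)
    {I J : Finset ℕ} (hIJ : I.card = J.card) {j : ℕ} (hj : j ∉ J) :
    ∃ Y : ℕ → A, ∀ i ∈ I, q • (qMinor q x I J * x i j) =
      x i j * qMinor q x I J + ∑ d ∈ J with d < j, x i d * Y d := by
  refine ⟨fun d => wordAct K x (insert j J) (I.sort (· ≤ ·)) (fun bs => algebraMap K A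
    (exchWord q (fun as cs => altVec q J as * altVec q {j} cs) bs [d])), fun i hi => ?_⟩
  have h := hx.exchWord_rows hq (insert j J) (isAlt_altVec q J) (isAlt_altVec q {j})
    (I := I) (I' := {i}) (by simp [finsetLT, hi])
  rw [Finset.inter_singleton_of_mem hi, Finset.card_singleton, pow_one, Finset.sort_singleton,
    wordAct_singleton (Finset.mem_insert_self j J),
    ← qMinor_eq_wordAct q x (Finset.subset_insert j J) hIJ] at h
  rw [h, wordAct_cons, Finset.sum_insert hj]
  simp only [wordAct_nil]
  congr 1
  · simp only [exchWord_altVec_singleton_right hq hj (d := j) (by simp), if_true]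
    rw [qMinor_eq_wordAct q x (Finset.subset_insert j J) hIJ]
    rfl
  · rw [Finset.sum_filter]
    refine Finset.sum_congr rfl fun d hd => ?_
    split_ifs with hdj
    · rfl
    · have : d ≠ j := fun h => hj (h ▸ hd)
      simp only [exchWord_altVec_singleton_right hq hj (d := d) (by simp [hdj]), this, if_false,
        map_zero]
      rw [show (fun _ : List ℕ => (0 : A)) = 0 from rfl, map_zero, mul_zero]

lemma IsFullQMatrix.exists_entry_mul_qMinor (hx : IsFullQMatrix q x) (hq : q ≠ 0)
    {I J : Finset ℕ} (hIJ : I.card = J.card) {j : ℕ} (hj : j ∉ J) :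
    ∃ Y : ℕ → A, ∀ i ∈ I, q • (x i j * qMinor q x I J) =
      qMinor q x I J * x i j + ∑ d ∈ J with j < d, Y d * x i d := by
  refine ⟨fun d => wordAct K x (insert j J) (I.sort (· ≤ ·)) (fun ds => algebraMap K A
    (exchWord q (fun as cs => altVec q {j} as * altVec q J cs) [d] ds)), fun i hi => ?_⟩
  have h := hx.exchWord_rows hq (insert j J) (isAlt_altVec q {j}) (isAlt_altVec q J)
    (I := {i}) (I' := I) (by simp [finsetLT, hi])
  rw [Finset.singleton_inter_of_mem hi, Finset.card_singleton, pow_one, Finset.sort_singleton,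
    wordAct_singleton (Finset.mem_insert_self j J),
    ← qMinor_eq_wordAct q x (Finset.subset_insert j J) hIJ] at h
  have h' : ∀ ds, wordAct K x (insert j J) [i] (fun bs => algebraMap K A
      (exchWord q (fun bs ds => altVec q {j} bs * altVec q J ds) bs ds)) =
      ∑ b ∈ insert j J, algebraMap K A
        (exchWord q (fun bs ds => altVec q {j} bs * altVec q J ds) [b] ds) * x i b := by
    intro ds
    simp only [wordAct_cons, wordAct_nil, Algebra.commutes]
  have h'' : ∀ F : ℕ → List ℕ → A, wordAct K x (insert j J) (I.sort (· ≤ ·))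
      (fun ds => ∑ b ∈ insert j J, F b ds * x i b) =
      ∑ b ∈ insert j J, wordAct K x (insert j J) (I.sort (· ≤ ·)) (F b) * x i b := by
    intro F
    simp only [← wordAct_mul_right, ← map_sum]
    congr 1
    funext ds
    simp
  rw [h]
  simp only [h']
  rw [h'', Finset.sum_insert hj]
  congr 1
  · simp only [exchWord_altVec_singleton_left hq hj (d := j) (by simp), if_true]
    rw [qMinor_eq_wordAct q x (Finset.subset_insert j J) hIJ]
    rfl
  · rw [Finset.sum_filter]
    refine Finset.sum_congr rfl fun d hd => ?_
    split_ifs with hdj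
    · rfl
    · have : d ≠ j := fun h => hj (h ▸ hd)
      simp only [exchWord_altVec_singleton_left hq hj (d := d) (by simp [hdj]), this, if_false,
        map_zero]
      rw [show (fun _ : List ℕ => (0 : A)) = 0 from rfl, map_zero, zero_mul]

/-- The element `y` inserted after the letters `p` of the column word `p ++ s`. -/
def insertedMinor (q : K) (x : ℕ → ℕ → A) (I : Finset ℕ) (y : A) (p s : List ℕ) : A :=
  wordAct K (fun i j => x j i) I p (fun r => y * wordAct K (fun i j => x j i) I s
    (fun r' => scalarVec A (altVec q I) (r ++ r')))

lemma insertedMinor_nil_left (I : Finset ℕ) (y : A) (s : List ℕ) :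
    insertedMinor q x I y [] s =
      y * wordAct K (fun i j => x j i) I s (scalarVec A (altVec q I)) := rfl

lemma insertedMinor_nil_right (I : Finset ℕ) (y : A) (p : List ℕ) :
    insertedMinor q x I y p [] =
      wordAct K (fun i j => x j i) I p (scalarVec A (altVec q I)) * y := by
  rw [← wordAct_mul_right]
  simp [insertedMinor, wordAct_nil, scalarVec, Algebra.commutes]

lemma insertedMinor_cons (I : Finset ℕ) (y : A) (p s : List ℕ) (j : ℕ) :
    insertedMinor q x I y p (j :: s) = wordAct K (fun i j => x j i) I p (fun r =>
      ∑ i ∈ I, y * x i j * wordAct K (fun i j => x j i) I s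
        (fun r' => scalarVec A (altVec q I) (r ++ i :: r'))) := by
  simp only [insertedMinor, wordAct_cons, Finset.mul_sum, mul_assoc]

lemma insertedMinor_append (I : Finset ℕ) (y : A) (p s : List ℕ) (j : ℕ) :
    insertedMinor q x I y (p ++ [j]) s = wordAct K (fun i j => x j i) I p (fun r =>
      ∑ i ∈ I, x i j * y * wordAct K (fun i j => x j i) I s
        (fun r' => scalarVec A (altVec q I) (r ++ i :: r'))) := by
  simp only [insertedMinor, wordAct_append, wordAct_cons, wordAct_nil, mul_assoc,
    List.append_assoc, List.singleton_append]

lemma insertedMinor_eq_zero_left (hx : IsFullQMatrix q x) (hq : q ≠ 0) (I : Finset ℕ) (y : A)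
    {p : List ℕ} (s : List ℕ) (hp : ¬ p.Nodup) : insertedMinor q x I y p s = 0 := by
  refine (IsAlt.wordAct hx.transpose hq I ?_).eq_zero_of_not_nodup hq hp
  intro u w a
  have h := fun r' => ((isAlt_altVec q I).scalarVec (A := A)).append_right r' u w a
  refine ⟨?_, fun b hb => ?_⟩
  · simp only [fun r' => (h r').1]
    rw [show (fun _ : List ℕ => (0 : A)) = 0 from rfl, map_zero, mul_zero]
  · show y * wordAct K (fun i j => x j i) I s _ = -(q • (y * wordAct K (fun i j => x j i) I s _))
    rw [show (fun r' => scalarVec A (altVec q I) (u ++ b :: a :: w ++ r')) =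
      -(q • fun r' => scalarVec A (altVec q I) (u ++ a :: b :: w ++ r')) from
      funext fun r' => (h r').2 b hb, map_neg, map_smul, mul_neg, mul_smul_comm]

lemma insertedMinor_eq_zero_right (hx : IsFullQMatrix q x) (hq : q ≠ 0) (I : Finset ℕ) (y : A)
    (p : List ℕ) {s : List ℕ} (hs : ¬ s.Nodup) : insertedMinor q x I y p s = 0 := by
  have h : ∀ r, wordAct K (fun i j => x j i) I s
      (fun r' => scalarVec A (altVec q I) (r ++ r')) = 0 := fun r =>
    (IsAlt.wordAct hx.transpose hq I
      ((isAlt_altVec q I).scalarVec.append_left r)).eq_zero_of_not_nodup hq hs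
  simp only [insertedMinor, h, mul_zero]
  exact map_zero _

lemma sum_wordAct_apply {ι : Type*} (x : ℕ → ℕ → A) (I : Finset ℕ) (s : Finset ι) (p : List ℕ)
    (F : ι → List ℕ → A) :
    ∑ d ∈ s, wordAct K x I p (F d) = wordAct K x I p (fun r => ∑ d ∈ s, F d r) := by
  rw [← map_sum]
  congr 1
  funext r
  simp

lemma insertedMinor_cons_of_mem (hx : IsFullQMatrix q x) (hq : q ≠ 0) {I J I' : Finset ℕ}
    (hIJ : I.card = J.card) (hI : I' ⊆ I) {j : ℕ} (hj : j ∈ J) (p s : List ℕ) :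
    insertedMinor q x I' (qMinor q x I J) p (j :: s) =
      insertedMinor q x I' (qMinor q x I J) (p ++ [j]) s := by
  rw [insertedMinor_cons, insertedMinor_append]
  congr 1
  funext r
  exact Finset.sum_congr rfl fun i hi => by rw [hx.qMinor_comm_entry hq hIJ (hI hi) hj]

lemma insertedMinor_cons_of_forall_lt (hx : IsFullQMatrix q x) (hq : q ≠ 0) {I J I' : Finset ℕ}
    (hIJ : I.card = J.card) (hI : I' ⊆ I) {j : ℕ} (hj : j ∉ J) {p : List ℕ}
    (hp : ∀ d ∈ J, d < j → d ∈ p) (s : List ℕ) :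
    insertedMinor q x I' (qMinor q x I J) p (j :: s) =
      q⁻¹ • insertedMinor q x I' (qMinor q x I J) (p ++ [j]) s := by
  obtain ⟨Y, hY⟩ := hx.exists_qMinor_mul_entry hq hIJ hj
  have h0 : ∑ d ∈ J with d < j, insertedMinor q x I' (Y d) (p ++ [d]) s = 0 := by
    refine Finset.sum_eq_zero fun d hd => insertedMinor_eq_zero_left hx hq I' _ s fun h => ?_
    rw [Finset.mem_filter] at hd
    have := hp d hd.1 hd.2
    simp [List.nodup_append] at h
    exact h.2 d this rfl
  have h : q • insertedMinor q x I' (qMinor q x I J) p (j :: s) =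
      insertedMinor q x I' (qMinor q x I J) (p ++ [j]) s +
        ∑ d ∈ J with d < j, insertedMinor q x I' (Y d) (p ++ [d]) s := by
    simp only [insertedMinor_append]
    rw [insertedMinor_cons, sum_wordAct_apply, ← map_add, ← map_smul]
    congr 1
    funext r
    simp only [Pi.smul_apply, Pi.add_apply, Finset.smul_sum]
    rw [Finset.sum_comm, ← Finset.sum_add_distrib]
    refine Finset.sum_congr rfl fun i hi => ?_
    rw [← Finset.sum_mul, ← add_mul, ← hY i (hI hi), smul_mul_assoc]
  rw [h0, add_zero] at h
  rw [← h, inv_smul_smul₀ hq]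

lemma insertedMinor_cons_of_forall_gt (hx : IsFullQMatrix q x) (hq : q ≠ 0) {I J I' : Finset ℕ}
    (hIJ : I.card = J.card) (hI : I' ⊆ I) {j : ℕ} (hj : j ∉ J) (p : List ℕ) {s : List ℕ}
    (hs : ∀ d ∈ J, j < d → d ∈ s) :
    insertedMinor q x I' (qMinor q x I J) p (j :: s) =
      q • insertedMinor q x I' (qMinor q x I J) (p ++ [j]) s := by
  obtain ⟨Y, hY⟩ := hx.exists_entry_mul_qMinor hq hIJ hj
  have h0 : ∑ d ∈ J with j < d, insertedMinor q x I' (Y d) p (d :: s) = 0 := by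
    refine Finset.sum_eq_zero fun d hd => insertedMinor_eq_zero_right hx hq I' _ p fun h => ?_
    rw [Finset.mem_filter] at hd
    simp [hs d hd.1 hd.2] at h
  have h : q • insertedMinor q x I' (qMinor q x I J) (p ++ [j]) s =
      insertedMinor q x I' (qMinor q x I J) p (j :: s) +
        ∑ d ∈ J with j < d, insertedMinor q x I' (Y d) p (d :: s) := by
    simp only [insertedMinor_cons]
    rw [insertedMinor_append, sum_wordAct_apply, ← map_add, ← map_smul]
    congr 1
    funext r
    simp only [Pi.smul_apply, Pi.add_apply, Finset.smul_sum]
    rw [Finset.sum_comm, ← Finset.sum_add_distrib]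
    refine Finset.sum_congr rfl fun i hi => ?_
    rw [← Finset.sum_mul, ← add_mul, ← hY i (hI hi), smul_mul_assoc]
  rw [h, h0, add_zero]

lemma insertedMinor_append_of_forall {I : Finset ℕ} {y : A} (κ : K) (l p s : List ℕ)
    (h : ∀ j ∈ l, ∀ p' s', p ⊆ p' → s ⊆ s' →
      insertedMinor q x I y p' (j :: s') = κ • insertedMinor q x I y (p' ++ [j]) s') :
    insertedMinor q x I y p (l ++ s) = κ ^ l.length • insertedMinor q x I y (p ++ l) s := by
  induction l generalizing p with
  | nil => simp
  | cons j l ih =>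
    rw [List.cons_append, h j List.mem_cons_self p _ (List.Subset.refl p)
      (List.subset_append_right l s), ih (p ++ [j]) fun j' hj' p' s' hp hs =>
        h j' (List.mem_cons_of_mem j hj') p' s'
          (fun a ha => hp (List.mem_append_left _ ha)) hs, smul_smul,
      List.append_assoc, List.singleton_append, List.length_cons, pow_succ']

lemma IsFullQMatrix.qMinor_mul_of_subset (hx : IsFullQMatrix q x) (hq : q ≠ 0)
    {I J I' J' J₁ J₂ : Finset ℕ} (hIJ : I.card = J.card) (hIJ' : I'.card = J'.card)
    (hI : I' ⊆ I) (hdisj : Disjoint J₁ J₂) (hunion : J₁ ∪ J₂ = J' \ J)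
    (h₁ : finsetLT J₁ (J \ J')) (h₂ : finsetLT (J \ J') J₂) :
    qMinor q x I J * qMinor q x I' J' =
      q ^ ((J₂.card : ℤ) - J₁.card) • (qMinor q x I' J' * qMinor q x I J) := by
  have hmem : ∀ a, (a ∈ J₁ ∨ a ∈ J₂) ↔ a ∈ J' ∧ a ∉ J := fun a => by
    rw [← Finset.mem_union, hunion, Finset.mem_sdiff]
  set B := qMinor q x I J with hB
  set w := J₂.sort (· ≤ ·) ++ ((J ∩ J').sort (· ≤ ·) ++ (J₁.sort (· ≤ ·) ++ [])) with hw
  have hperm : w.Perm (J'.sort (· ≤ ·)) := by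
    refine (List.perm_ext_iff_of_nodup ?_ (J'.sort_nodup _)).2 fun a => ?_
    · simp only [hw, List.append_nil, List.nodup_append, Finset.sort_nodup, true_and,
        Finset.mem_sort, List.mem_append, Finset.mem_inter]
      refine ⟨fun a ha b hb => ?_, fun a ha b hb => ?_⟩ <;> rintro rfl
      · exact ((hmem a).1 (Or.inl hb)).2 ha.1
      · rcases hb with hb | hb
        · exact ((hmem a).1 (Or.inr ha)).2 hb.1
        · exact Finset.disjoint_left.1 hdisj hb ha
    · have := hmem a
      simp only [hw, List.append_nil, List.mem_append, Finset.mem_sort, Finset.mem_inter]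
      tauto
  have hJ' : wordAct K (fun i j => x j i) I' (J'.sort (· ≤ ·)) (scalarVec A (altVec q I')) =
      qMinor q x I' J' := by
    rw [← qMinor_eq_wordAct q _ (Finset.Subset.refl I') hIJ'.symm, hx.qMinor_transpose hIJ']
  obtain ⟨κ, hκ⟩ := (IsAlt.wordAct hx.transpose hq I'
    ((isAlt_altVec q I').scalarVec (A := A))).exists_smul hq hperm
  rw [hJ'] at hκ
  have key : insertedMinor q x I' B [] w =
      q ^ ((J₂.card : ℤ) - J₁.card) • insertedMinor q x I' B w [] := by
    rw [hw, insertedMinor_append_of_forall q, insertedMinor_append_of_forall 1,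
      insertedMinor_append_of_forall q⁻¹]
    · simp only [List.nil_append, List.append_nil, List.append_assoc, Finset.length_sort, one_pow,
        one_mul, smul_smul, inv_pow]
      rw [zpow_sub₀ hq, zpow_natCast, zpow_natCast, div_eq_mul_inv]
    · intro j hj p s hp _
      rw [Finset.mem_sort] at hj
      refine insertedMinor_cons_of_forall_lt hx hq hIJ hI ((hmem j).1 (Or.inl hj)).2 ?_ s
      intro d hd hdj
      refine hp (List.mem_append_right _ ?_)
      rw [Finset.mem_sort, Finset.mem_inter]
      refine ⟨hd, by_contra fun hd' => ?_⟩
      exact absurd (h₁ j hj d (Finset.mem_sdiff.2 ⟨hd, hd'⟩)) hdj.not_gt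
    · intro j hj p s _ _
      rw [Finset.mem_sort, Finset.mem_inter] at hj
      rw [one_smul]
      exact insertedMinor_cons_of_mem hx hq hIJ hI hj.1 p s
    · intro j hj p s _ hs
      rw [Finset.mem_sort] at hj
      refine insertedMinor_cons_of_forall_gt hx hq hIJ hI ((hmem j).1 (Or.inr hj)).2 p ?_
      intro d hd hdj
      refine hs (List.mem_append_left _ ?_)
      rw [Finset.mem_sort, Finset.mem_inter]
      refine ⟨hd, by_contra fun hd' => ?_⟩
      exact absurd (h₂ d (Finset.mem_sdiff.2 ⟨hd, hd'⟩) j hj) hdj.not_gt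
  rw [insertedMinor_nil_left, insertedMinor_nil_right] at key
  rw [hκ, mul_smul_comm, key, smul_mul_assoc, smul_comm]

/-- The extension of a matrix by zero outside of the rows `1, …, m` and columns `1, …, n`. -/
def extendByZero (m n : ℕ) (x : ℕ → ℕ → A) (i j : ℕ) : A :=
  if i ∈ Finset.Icc 1 m ∧ j ∈ Finset.Icc 1 n then x i j else 0

lemma isFullQMatrix_extendByZero {m n : ℕ} (hx : IsQMatrix q m n x) :
    IsFullQMatrix q (extendByZero m n x) where
  row i j k h := by
    simp only [extendByZero, Finset.mem_Icc]
    split_ifs with h1 h2 h2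
    · exact hx.1 i j k h1.1.1 h1.1.2 h1.2.1 h h2.2.2
    all_goals simp
  col j i l h := by
    simp only [extendByZero, Finset.mem_Icc]
    split_ifs with h1 h2 h2
    · exact hx.2.1 i l j h1.1.1 h h2.1.2 h1.2.1 h1.2.2
    all_goals simp
  anti {i l j k} h h' := by
    simp only [extendByZero, Finset.mem_Icc]
    split_ifs with h1 h2 h2
    · exact hx.2.2.1 i l j k h1.1.1 h h2.1.2 h2.2.1 h' h1.2.2
    all_goals simp
  diag {i l j k} h h' := by
    by_cases hr : (1 ≤ i ∧ l ≤ m) ∧ 1 ≤ j ∧ k ≤ n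
    · obtain ⟨⟨h1, h2⟩, h3, h4⟩ := hr
      have := hx.2.2.2 i l j k h1 h h2 h3 h' h4
      simp only [extendByZero, Finset.mem_Icc]
      rw [if_pos (by omega), if_pos (by omega), if_pos (by omega), if_pos (by omega), ← this]
      abel
    · have h1 : extendByZero m n x i j = 0 ∨ extendByZero m n x l k = 0 := by
        simp only [extendByZero, Finset.mem_Icc]
        by_cases h1 : 1 ≤ i ∧ 1 ≤ j
        · exact Or.inr (if_neg (by omega))
        · exact Or.inl (if_neg (by omega))
      have h2 : extendByZero m n x i k = 0 ∨ extendByZero m n x l j = 0 := by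
        simp only [extendByZero, Finset.mem_Icc]
        by_cases h1 : 1 ≤ i ∧ k ≤ n
        · exact Or.inr (if_neg (by omega))
        · exact Or.inl (if_neg (by omega))
      rcases h1 with h1 | h1 <;> rcases h2 with h2 | h2 <;> simp [h1, h2]

lemma qMinor_extendByZero {m n : ℕ} {I J : Finset ℕ} (hI : I ⊆ Finset.Icc 1 m)
    (hJ : J ⊆ Finset.Icc 1 n) : qMinor q (extendByZero m n x) I J = qMinor q x I J := by
  unfold qMinor
  have h : ∀ a ∈ I, ∀ b ∈ J, extendByZero m n x a b = x a b := fun a ha b hb =>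
    if_pos ⟨hI ha, hJ hb⟩
  simp only [h _ (Finset.orderEmbOfFin_mem _ _ _) _ (Finset.orderEmbOfFin_mem _ _ _)]

lemma zpow_smul_of_pow_smul (hq : q ≠ 0) {a b : ℕ} {y z : A} (h : q ^ a • y = q ^ b • z) :
    y = q ^ ((b : ℤ) - a) • z := by
  rw [zpow_sub₀ hq, zpow_natCast, zpow_natCast, div_eq_inv_mul, mul_smul, ← h,
    inv_smul_smul₀ (pow_ne_zero a hq)]

end Quasicommutation

end QuantumMinor

/-- The exponent `c` in the quasicommutation of general quantum minors, in each of
the four possible cases. -/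
theorem qMinor_quasicommute_exponent
    {m n : ℕ} (S : Cortege m n) (hcard : S.I'.card ≤ S.I.card)
    (hwsI : WeaklySeparated S.I S.I') (hwsJ : WeaklySeparated S.J S.J')
    (c : ℤ)
    (hcase :
      (S.I' \ S.I = ∅ ∧ ∃ J₁ J₂ : Finset ℕ, Disjoint J₁ J₂ ∧ J₁ ∪ J₂ = S.J' \ S.J ∧
        finsetLT J₁ (S.J \ S.J') ∧ finsetLT (S.J \ S.J') J₂ ∧
        c = (J₂.card : ℤ) - (J₁.card : ℤ)) ∨
      (S.J' \ S.J = ∅ ∧ ∃ I₁ I₂ : Finset ℕ, Disjoint I₁ I₂ ∧ I₁ ∪ I₂ = S.I' \ S.I ∧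
        finsetLT I₁ (S.I \ S.I') ∧ finsetLT (S.I \ S.I') I₂ ∧
        c = (I₂.card : ℤ) - (I₁.card : ℤ)) ∨
      (finsetLT (S.I \ S.I') (S.I' \ S.I) ∧ finsetLT (S.J' \ S.J) (S.J \ S.J') ∧
        c = ((S.I' \ S.I).card : ℤ) - ((S.J' \ S.J).card : ℤ)) ∨
      (finsetLT (S.I' \ S.I) (S.I \ S.I') ∧ finsetLT (S.J \ S.J') (S.J' \ S.J) ∧
        c = ((S.J' \ S.J).card : ℤ) - ((S.I' \ S.I).card : ℤ))) :
    ∀ (K : Type) [Field K] (q : K), q ≠ 0 →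
      ∀ (A : Type) [Ring A] [Algebra K A] (x : ℕ → ℕ → A), IsQMatrix q m n x →
        qMinor q x S.I S.J * qMinor q x S.I' S.J' =
          (q ^ c) • (qMinor q x S.I' S.J' * qMinor q x S.I S.J) := by
  intro K _ q hq A _ _ x hx
  have hy := QuantumMinor.isFullQMatrix_extendByZero hx
  rw [← QuantumMinor.qMinor_extendByZero S.hIm S.hJn,
    ← QuantumMinor.qMinor_extendByZero S.hI'm S.hJ'n]
  have hI := Finset.card_sdiff_add_card_inter S.I' S.I
  have hJ := Finset.card_sdiff_add_card_inter S.J' S.J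
  rw [Finset.inter_comm] at hI hJ
  have hIJ' := S.hI'J'
  rcases hcase with ⟨hI', J₁, J₂, hd, hu, h₁, h₂, rfl⟩ | ⟨hJ', I₁, I₂, hd, hu, h₁, h₂, rfl⟩ |
    ⟨h₁, h₂, rfl⟩ | ⟨h₁, h₂, rfl⟩
  · exact hy.qMinor_mul_of_subset hq S.hIJ S.hI'J' (Finset.sdiff_eq_empty_iff_subset.1 hI') hd hu
      h₁ h₂
  · rw [← hy.qMinor_transpose S.hIJ, ← hy.qMinor_transpose S.hI'J']
    exact hy.transpose.qMinor_mul_of_subset hq S.hIJ.symm S.hI'J'.symm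
      (Finset.sdiff_eq_empty_iff_subset.1 hJ') hd hu h₁ h₂
  · rw [QuantumMinor.zpow_smul_of_pow_smul hq
      (hy.qMinor_mul_of_finsetLT hq S.hIJ S.hI'J' h₁ h₂)]
    congr 2
    omega
  · rw [← hy.qMinor_transpose S.hIJ, ← hy.qMinor_transpose S.hI'J',
      QuantumMinor.zpow_smul_of_pow_smul hq
        (hy.transpose.qMinor_mul_of_finsetLT hq S.hIJ.symm S.hI'J'.symm h₂ h₁)]
    congr 2
    omega
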